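/- arXiv:2404.09815 — 10 statements merged into one kernel-verified Lean document; each statement's English description precedes it below -/
import Mathlib

section
/- Let a, b : ℤ → ℝ with a(n) ≠ 0 for every n ∈ ℤ, and suppose that for each n ∈ ℤ the family (l : ℕ) ↦ b(n−l−1)·∏_{k=0}^{l} (a(n−k−1))⁻¹ is summable. Define f : ℤ → ℝ by f(n) = −∑_{l=0}^{∞} b(n−l−1)·∏_{k=0}^{l} (a(n−k−1))⁻¹ (the tsum over l ∈ ℕ, with the finite products over k = 0,…,l). Then f solves the inhomogeneous difference relation f(n) = f(n+1)·a(n) + b(n) for all n ∈ ℤ. -/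
/-- Inhomogeneous case of the difference recursion `f(n) = f(n+1)·a(n) + b(n)`:
if `a : ℤ → ℝ` is nowhere zero and for each `n` the family
`l ↦ b(n−l−1)·∏_{k=0}^{l} (a(n−k−1))⁻¹` (over `l : ℕ`) is summable, then
`f(n) := −∑_{l=0}^{∞} b(n−l−1)·∏_{k=0}^{l} (a(n−k−1))⁻¹` satisfies
`f(n) = f(n+1)·a(n) + b(n)` for all `n`. -/
theorem stmt1 (a b : ℤ → ℝ) (ha : ∀ n : ℤ, a n ≠ 0)
    (hs : ∀ n : ℤ, Summable fun l : ℕ =>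
      b (n - (l : ℤ) - 1) * ∏ k ∈ Finset.range (l + 1), (a (n - (k : ℤ) - 1))⁻¹)
    (f : ℤ → ℝ)
    (hf : ∀ n : ℤ, f n = -∑' l : ℕ,
      b (n - (l : ℤ) - 1) * ∏ k ∈ Finset.range (l + 1), (a (n - (k : ℤ) - 1))⁻¹) :
    ∀ n : ℤ, f n = f (n + 1) * a n + b n := by
  intro n
  rw [hf (n + 1), (hs (n + 1)).tsum_eq_zero_add, hf n]
  have key : ∀ l : ℕ, b (n + 1 - ((l + 1 : ℕ) : ℤ) - 1) *
      ∏ k ∈ Finset.range (l + 1 + 1), (a (n + 1 - (k : ℤ) - 1))⁻¹ =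
      (a n)⁻¹ * (b (n - (l : ℤ) - 1) *
        ∏ k ∈ Finset.range (l + 1), (a (n - (k : ℤ) - 1))⁻¹) := by
    intro l
    rw [Finset.prod_range_succ']
    have h1 : n + 1 - ((l + 1 : ℕ) : ℤ) - 1 = n - (l : ℤ) - 1 := by push_cast; ring
    have h2 : ∀ k : ℕ, n + 1 - ((k + 1 : ℕ) : ℤ) - 1 = n - (k : ℤ) - 1 := by
      intro k; push_cast; ring
    have h3 : n + 1 - ((0 : ℕ) : ℤ) - 1 = n := by push_cast; ring
    simp only [h2, h3]
    ring
  simp only [key]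
  rw [tsum_mul_left]
  have h3 : n + 1 - ((0 : ℕ) : ℤ) - 1 = n := by push_cast; ring
  simp only [zero_add, Finset.prod_range_one, h3]
  have := ha n
  field_simp
  ring
end

section
/- Let R be a commutative ring, N ∈ ℤ, and let Ã : ℤ → ℤ → R be a pseudo-difference operator coefficient family with Ã_i = 0 for all i > N. Set A := Ã∘(Λ−Λ⁻¹), i.e. A_i(n) = Ã_{i−1}(n) − Ã_{i+1}(n), and let B̃ : ℤ → ℤ → R satisfy B̃_i = 0 for i < −N; set B := B̃∘(Λ⁻¹−Λ), i.e. B_i(n) = B̃_{i+1}(n) − B̃_{i−1}(n). Assume the adjoint relation A*∘(Λ−Λ⁻¹) = (Λ−Λ⁻¹)∘B holds (coefficientwise). Then: (1) B̃ = Ã*, and (2) (Ã_{≥0} + B̃_{<0})∘(Λ−Λ⁻¹) = A_{≥1} − B_{≤−1} − (A_{≥1} − B_{≤−1})|_{Λ=1}, where the last term is the multiplication operator by the (finite-sum) function n ↦ ∑_{i≥1} A_i(n) − ∑_{i≤−1} B_i(n). -/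
/-!
Pseudo-difference operators over a commutative ring `R` are encoded by coefficient
families `C : ℤ → ℤ → R`, where `C i n` is the coefficient of `Λ^i` at site `n` in
`C = ∑_{i∈ℤ} C_i(n) Λ^i`, `Λ` being the shift operator `(Λ f)(n) = f (n+1)`.
-/

namespace BKP

variable {R : Type*} [CommRing R]

/-- Composition of pseudo-difference operators:
`(C∘D)_p(n) = ∑_{i+j=p} C_i(n) · D_j(n+i)` (a `finsum`, well defined when finitely
many terms are nonzero). -/
noncomputable def comp (C D : ℤ → ℤ → R) : ℤ → ℤ → R :=
  fun p n => ∑ᶠ i : ℤ, C i n * D (p - i) (n + i)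

/-- Formal adjoint: `(C*)_i(n) = C_{−i}(n+i)`. -/
def adj (C : ℤ → ℤ → R) : ℤ → ℤ → R := fun i n => C (-i) (n + i)

/-- The operator `Λ^m`: coefficient `1` at `i = m`, `0` elsewhere.  `shift 0` is the
identity operator. -/
def shift (m : ℤ) : ℤ → ℤ → R := fun i _ => if i = m then (1 : R) else 0

/-- The operator `Λ − Λ⁻¹`: coefficient `1` at `i = 1` and `−1` at `i = −1`. -/
def lam : ℤ → ℤ → R := fun i _ => if i = 1 then (1 : R) else if i = -1 then -1 else 0

/-- Truncation `C_{≥m}`. -/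
def truncGe (m : ℤ) (C : ℤ → ℤ → R) : ℤ → ℤ → R := fun i n => if m ≤ i then C i n else 0

/-- Truncation `C_{≤m}`. -/
def truncLe (m : ℤ) (C : ℤ → ℤ → R) : ℤ → ℤ → R := fun i n => if i ≤ m then C i n else 0

/-- Truncation `C_{<m}`. -/
def truncLt (m : ℤ) (C : ℤ → ℤ → R) : ℤ → ℤ → R := fun i n => if i < m then C i n else 0

/-- Power of a pseudo-difference operator. -/
noncomputable def powOp (C : ℤ → ℤ → R) : ℕ → ℤ → ℤ → R
  | 0 => shift 0
  | m + 1 => comp C (powOp C m)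

end BKP

theorem bkp_comp_lam {R : Type*} [CommRing R] (C : ℤ → ℤ → R) (p n : ℤ) :
    BKP.comp C BKP.lam p n = C (p - 1) n - C (p + 1) n := by
  unfold BKP.comp BKP.lam
  rw [finsum_eq_sum_of_support_subset (s := {p - 1, p + 1})]
  · rw [Finset.sum_pair (by omega)]
    rw [if_pos (by omega), if_neg (by omega), if_pos (by omega)]
    ring
  · intro i hi
    rw [Function.mem_support] at hi
    simp only [Finset.coe_insert, Finset.coe_singleton, Set.mem_insert_iff, Set.mem_singleton_iff]
    by_contra h
    apply hi
    rw [if_neg (by omega), if_neg (by omega), mul_zero]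

theorem bkp_lam_comp {R : Type*} [CommRing R] (C : ℤ → ℤ → R) (p n : ℤ) :
    BKP.comp BKP.lam C p n = C (p - 1) (n + 1) - C (p + 1) (n - 1) := by
  unfold BKP.comp BKP.lam
  rw [finsum_eq_sum_of_support_subset (s := {1, -1})]
  · rw [Finset.sum_pair (by omega)]
    rw [if_pos rfl, if_neg (by omega), if_pos rfl, sub_neg_eq_add, ← sub_eq_add_neg n 1]
    ring
  · intro i hi
    rw [Function.mem_support] at hi
    simp only [Finset.coe_insert, Finset.coe_singleton, Set.mem_insert_iff, Set.mem_singleton_iff]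
    by_contra h
    apply hi
    rw [if_neg (by omega), if_neg (by omega), zero_mul]

theorem bkp_tele {R : Type*} [CommRing R] (N : ℤ) (f : ℤ → R) (hf : ∀ i, N < i → f i = 0) :
    (∑ᶠ i : ℤ, if 1 ≤ i then f (i - 1) - f (i + 1) else 0) = f 0 + f 1 := by
  set g : ℤ → R := fun i => if 0 ≤ i then f i else 0 with hg
  set h : ℤ → R := fun i => if 2 ≤ i then f i else 0 with hh
  have fin : ∀ (m k : ℤ), (Function.support fun i : ℤ => if m ≤ i + k then f (i + k) else 0).Finite := by
    intro m k
    apply (Set.finite_Icc (m - k) (N - k)).subset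
    intro i hi
    rw [Function.mem_support] at hi
    constructor
    · by_contra h1
      exact hi (if_neg (by omega))
    · by_contra h1
      apply hi
      rw [hf _ (by omega), ite_self]
  have e1 : ∑ᶠ i : ℤ, g (i + (-1)) = ∑ᶠ i, g i := finsum_comp_equiv (Equiv.addRight (-1 : ℤ))
  have e2 : ∑ᶠ i : ℤ, h (i + 1) = ∑ᶠ i, h i := finsum_comp_equiv (Equiv.addRight (1 : ℤ))
  have e3 : ∀ i : ℤ, (if 1 ≤ i then f (i - 1) - f (i + 1) else 0) = g (i + (-1)) - h (i + 1) := by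
    intro i
    simp only [hg, hh, ← sub_eq_add_neg i 1]
    by_cases hi : 1 ≤ i
    · rw [if_pos hi, if_pos (by omega), if_pos (by omega)]
    · rw [if_neg hi, if_neg (by omega), if_neg (by omega), sub_zero]
  have fg : (Function.support g).Finite := by simpa using fin 0 0
  have fh : (Function.support h).Finite := by simpa using fin 2 0
  rw [finsum_congr e3, finsum_sub_distrib (fin 0 (-1)) (fin 2 1), e1, e2,
    ← finsum_sub_distrib fg fh,
    finsum_eq_sum_of_support_subset (s := {0, 1})]
  · rw [Finset.sum_pair (by omega)]
    simp [hg, hh]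
  · intro i hi
    rw [Function.mem_support] at hi
    simp only [Finset.coe_insert, Finset.coe_singleton, Set.mem_insert_iff, Set.mem_singleton_iff]
    by_contra hc
    apply hi
    simp only [hg, hh]
    by_cases h2 : 2 ≤ i
    · rw [if_pos h2, if_pos (by omega), sub_self]
    · rw [if_neg h2, if_neg (by omega), sub_self]

/-- Lemma on factoring through `Λ − Λ⁻¹`:  if `Ã` is supported in powers `≤ N`,
`B̃` in powers `≥ −N`, `A = Ã∘(Λ−Λ⁻¹)` (i.e. `A_i(n) = Ã_{i−1}(n) − Ã_{i+1}(n)`),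
`B = B̃∘(Λ⁻¹−Λ)` (i.e. `B_i(n) = B̃_{i+1}(n) − B̃_{i−1}(n)`), and the adjoint relation
`A*∘(Λ−Λ⁻¹) = (Λ−Λ⁻¹)∘B` holds, then `B̃ = Ã*` and
`(Ã_{≥0} + B̃_{<0})∘(Λ−Λ⁻¹) = A_{≥1} − B_{≤−1} − (A_{≥1} − B_{≤−1})|_{Λ=1}`,
the last term being the multiplication operator by
`n ↦ ∑_{i≥1} A_i(n) − ∑_{i≤−1} B_i(n)`. -/
theorem stmt3 {R : Type*} [CommRing R] (N : ℤ) (At Bt A B : ℤ → ℤ → R)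
    (hAt : ∀ i : ℤ, N < i → ∀ n : ℤ, At i n = 0)
    (hBt : ∀ i : ℤ, i < -N → ∀ n : ℤ, Bt i n = 0)
    (hAdef : ∀ i n : ℤ, A i n = At (i - 1) n - At (i + 1) n)
    (hBdef : ∀ i n : ℤ, B i n = Bt (i + 1) n - Bt (i - 1) n)
    (hadj : BKP.comp (BKP.adj A) BKP.lam = BKP.comp BKP.lam B) :
    Bt = BKP.adj At ∧
      BKP.comp (fun i n => BKP.truncGe 0 At i n + BKP.truncLt 0 Bt i n) BKP.lam =
        fun i n =>
          BKP.truncGe 1 A i n - BKP.truncLe (-1) B i n -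
            (if i = 0 then
              (∑ᶠ i' : ℤ, BKP.truncGe 1 A i' n) - ∑ᶠ i' : ℤ, BKP.truncLe (-1) B i' n
            else 0) := by
  have key : ∀ k : ℕ, ∀ p : ℤ, p < -N + k → ∀ n, Bt p n = At (-p) (n + p) := by
    intro k
    induction k with
    | zero =>
      intro p hp n
      rw [hBt p (by simpa using hp), hAt (-p) (by push_cast at hp; omega)]
    | succ k ih =>
      intro p hp n
      push_cast at hp
      have h := congrFun (congrFun hadj (p - 2)) (n + 1)
      rw [bkp_comp_lam, bkp_lam_comp] at h
      simp only [BKP.adj, hAdef, hBdef] at h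
      have h1 := ih (p - 2) (by omega) (n + 1 + 1)
      have h2 := ih (p - 2) (by omega) n
      have h3 := ih (p - 4) (by omega) (n + 1 + 1)
      ring_nf at h h1 h2 h3 ⊢
      linear_combination h + h1 + h2 - h3
  have hB : ∀ p n, Bt p n = At (-p) (n + p) := fun p n =>
    key (p + N + 1).toNat p (by omega) n
  refine ⟨funext fun p => funext fun n => hB p n, ?_⟩
  funext i n
  have h0 : Bt 0 n = At 0 n := by simpa using hB 0 n
  have sA : (∑ᶠ i' : ℤ, BKP.truncGe 1 A i' n) = At 0 n + At 1 n := by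
    rw [← bkp_tele N (fun i => At i n) (fun i hi => hAt i hi n)]
    simp only [BKP.truncGe, hAdef]
  have sB : (∑ᶠ i' : ℤ, BKP.truncLe (-1) B i' n) = Bt 0 n + Bt (-1) n := by
    have := bkp_tele N (fun i => Bt (-i) n) (fun i hi => hBt (-i) (by omega) n)
    rw [neg_zero] at this
    rw [← this, ← finsum_comp_equiv (Equiv.neg ℤ)]
    apply finsum_congr
    intro j
    simp only [BKP.truncLe, hBdef, Equiv.neg_apply]
    by_cases hj : 1 ≤ j
    · rw [if_pos hj, if_pos (by omega)]
      ring_nf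
    · rw [if_neg hj, if_neg (by omega)]
  rw [bkp_comp_lam, sA, sB]
  simp only [BKP.truncGe, BKP.truncLe, BKP.truncLt, hAdef, hBdef]
  rcases lt_trichotomy i 0 with hi | rfl | hi
  · by_cases h1 : i = -1
    · subst h1
      norm_num [h0]
    · rw [if_neg (by omega), if_pos (by omega), if_neg (by omega), if_pos (by omega),
        if_neg (by omega), if_pos (by omega), if_neg (by omega)]
      ring
  · norm_num [h0]
  · rw [if_pos (by omega), if_neg (by omega), if_pos (by omega), if_neg (by omega),
      if_pos (by omega), if_neg (by omega), if_neg (by omega)]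
    ring
end

section
/- Let R be a commutative ring and k ≥ 1. Let A, B : ℤ → ℤ → R be pseudo-difference operator coefficient families with A_i = 0 for i > k and B_i = 0 for i < −k, satisfying the adjoint relation A*∘(Λ−Λ⁻¹) = (Λ−Λ⁻¹)∘B (coefficientwise). Define E := Δ∘A∘ι_{Λ⁻¹}Δ⁻¹ and F := Δ∘B∘ι_{Λ}Δ⁻¹, where Δ := Λ−1, ι_{Λ⁻¹}Δ⁻¹ := ∑_{m≥1} Λ^{−m} and ι_{Λ}Δ⁻¹ := −∑_{m≥0} Λ^{m} (the two geometric expansions of (Λ−1)⁻¹; all coefficients of E and F are finite sums under the support conditions). Then for every n ∈ ℤ, E_0(n) + F_0(n) = 2·( ∑_{i≥0} E_i(n−i) − ∑_{i<0} F_i(n−i) ); equivalently E_{[0]} + F_{[0]} = 2·( (E_{≥0})* − (F_{<0})* )|_{Λ=1}. -/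
/-- The operator `Δ = Λ − 1`. -/
def deltaOp {R : Type*} [CommRing R] : ℤ → ℤ → R :=
  fun i _ => if i = 1 then 1 else if i = 0 then -1 else 0

/-- `ι_{Λ⁻¹}Δ⁻¹ = ∑_{m≥1} Λ^{−m}`: coefficient `1` at every `i ≤ −1`. -/
def iotaNegInvDelta {R : Type*} [CommRing R] : ℤ → ℤ → R :=
  fun i _ => if i ≤ -1 then 1 else 0

/-- `ι_{Λ}Δ⁻¹ = −∑_{m≥0} Λ^{m}`: coefficient `−1` at every `i ≥ 0`. -/
def iotaPosInvDelta {R : Type*} [CommRing R] : ℤ → ℤ → R :=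
  fun i _ => if 0 ≤ i then -1 else 0

theorem aux_finsum_two {R : Type*} [CommRing R] (f : ℤ → R) (a b : ℤ) (hab : a ≠ b)
    (h : ∀ i, i ≠ a → i ≠ b → f i = 0) : ∑ᶠ i : ℤ, f i = f a + f b := by
  rw [finsum_eq_sum_of_support_subset (s := {a, b}) f, Finset.sum_pair hab]
  intro i hi
  by_contra hc
  simp at hc
  exact hi (h i hc.1 hc.2)

theorem aux_delta {R : Type*} [CommRing R] (D : ℤ → ℤ → R) (p n : ℤ) :
    BKP.comp deltaOp D p n = D (p - 1) (n + 1) - D p n := by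
  unfold BKP.comp
  rw [aux_finsum_two _ 1 0 (by norm_num)]
  · simp [deltaOp]; ring
  · intro i h1 h0
    simp [deltaOp, h1, h0]

theorem aux_lamL {R : Type*} [CommRing R] (D : ℤ → ℤ → R) (p n : ℤ) :
    BKP.comp BKP.lam D p n = D (p - 1) (n + 1) - D (p + 1) (n - 1) := by
  unfold BKP.comp
  rw [aux_finsum_two _ 1 (-1) (by norm_num)]
  · simp [BKP.lam, sub_eq_add_neg]
  · intro i h1 h0
    simp [BKP.lam, h1, h0]

theorem aux_lamR {R : Type*} [CommRing R] (D : ℤ → ℤ → R) (p n : ℤ) :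
    BKP.comp D BKP.lam p n = D (p - 1) n - D (p + 1) n := by
  unfold BKP.comp
  rw [aux_finsum_two _ (p - 1) (p + 1) (by omega)]
  · simp [BKP.lam]; ring
  · intro i h1 h0
    have h2 : p - i ≠ 1 := by omega
    have h3 : p - i ≠ -1 := by omega
    simp [BKP.lam, h2, h3]

theorem aux_iotaN {R : Type*} [CommRing R] (k : ℤ) (A : ℤ → ℤ → R)
    (hA : ∀ i : ℤ, k < i → ∀ n : ℤ, A i n = 0) (p n : ℤ) :
    BKP.comp A iotaNegInvDelta p n = ∑ i ∈ Finset.Ioc p k, A i n := by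
  unfold BKP.comp
  rw [finsum_eq_sum_of_support_subset (s := Finset.Ioc p k)]
  · apply Finset.sum_congr rfl
    intro i hi
    simp at hi
    have : p - i ≤ -1 := by omega
    simp [iotaNegInvDelta, this]
  · intro i hi
    by_contra hc
    apply hi
    simp at hc
    by_cases h : p < i
    · simp [hA i (hc h)]
    · have : ¬ (p - i ≤ -1) := by omega
      simp [iotaNegInvDelta, this]

theorem aux_iotaP {R : Type*} [CommRing R] (k : ℤ) (B : ℤ → ℤ → R)
    (hB : ∀ i : ℤ, i < -k → ∀ n : ℤ, B i n = 0) (p n : ℤ) :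
    BKP.comp B iotaPosInvDelta p n = - ∑ i ∈ Finset.Icc (-k) p, B i n := by
  unfold BKP.comp
  rw [finsum_eq_sum_of_support_subset (s := Finset.Icc (-k) p), ← Finset.sum_neg_distrib]
  · apply Finset.sum_congr rfl
    intro i hi
    simp at hi
    have : i ≤ p := by omega
    simp [iotaPosInvDelta, this]
  · intro i hi
    by_contra hc
    apply hi
    simp only [Finset.coe_Icc, Set.mem_Icc] at hc
    by_cases h : i ≤ p
    · simp [hB i (by omega)]
    · simp [iotaPosInvDelta, h]

theorem aux_tele {R : Type*} [CommRing R] (k : ℤ) (S : ℤ → R)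
    (hS : ∀ i, k < i → S i = 0) :
    ∑ᶠ i : ℤ, (if 0 ≤ i then S i - S (i + 1) else 0) = S 0 := by
  rw [finsum_eq_sum_of_support_subset
    (s := (Finset.range (k + 1).toNat).map Nat.castEmbedding), Finset.sum_map]
  · have := Finset.sum_range_sub' (fun l : ℕ => S (l : ℤ)) (k + 1).toNat
    simp only [Nat.cast_add, Nat.cast_one, Nat.cast_zero] at this
    rw [hS ((k + 1).toNat : ℤ) (by omega), sub_zero] at this
    rw [← this]
    apply Finset.sum_congr rfl
    intro l _
    simp
  · intro i hi
    by_contra hc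
    apply hi
    by_cases h : 0 ≤ i
    · have hk : k < i := by
        by_contra hk
        apply hc
        simp only [Finset.coe_map, Set.mem_image, Finset.mem_coe, Finset.mem_range]
        exact ⟨i.toNat, by omega, by simp [h]⟩
      simp [hS i hk, hS (i + 1) (by omega)]
    · simp [h]

theorem aux_down (k : ℤ) (P : ℤ → Prop) (h0 : ∀ t, k < t → P t)
    (h1 : ∀ t, P (t + 1) → P (t + 2) → P t) (t : ℤ) : P t := by
  have key : ∀ r : ℕ, ∀ t, k < t + r → P t := by
    intro r
    induction r with
    | zero => intro t ht; exact h0 t (by simpa using ht)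
    | succ r ih =>
      intro t ht
      push_cast at ht
      exact h1 t (ih _ (by omega)) (ih _ (by omega))
  exact key (k + 1 - t).toNat t (by omega)

theorem aux_V {R : Type*} [CommRing R] (k : ℤ) (b : ℤ → R)
    (hb : ∀ i, k < i → b i = 0) :
    ∃ V : ℤ → R, (∀ t, k < t → V t = 0) ∧ ∀ t, V t = b t + V (t + 2) := by
  refine ⟨fun t => ∑ i ∈ Finset.Icc t k, if Even (i - t) then b i else 0, ?_, ?_⟩
  · intro t ht
    simp [Finset.Icc_eq_empty (not_le.mpr ht)]
  · intro t
    show (∑ i ∈ Finset.Icc t k, if Even (i - t) then b i else 0) = b t + ∑ i ∈ Finset.Icc (t + 2) k, if Even (i - (t + 2)) then b i else 0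
    by_cases h : t ≤ k
    · rw [← Finset.sum_erase_add _ _ (Finset.mem_Icc.2 ⟨le_refl t, h⟩), add_comm]
      simp only [sub_self, Even.zero, if_true]
      congr 1
      symm
      apply Finset.sum_subset_zero_on_sdiff
      · intro i hi
        simp at hi ⊢
        omega
      · intro i hi
        simp at hi
        have : i = t + 1 := by omega
        subst this
        simp
      · intro i _
        have : Even (i - (t + 2)) ↔ Even (i - t) := by
          rw [Int.even_iff, Int.even_iff]; omega
        simp [this]
    · rw [Finset.Icc_eq_empty (by omega), Finset.Icc_eq_empty (by omega), hb t (by omega)]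
      simp

theorem aux_recA {R : Type*} [CommRing R] (k : ℤ) (a : ℤ → R)
    (ha : ∀ i, k < i → a i = 0) (p : ℤ) :
    ∑ i ∈ Finset.Ioc (p - 1) k, a i = a p + ∑ i ∈ Finset.Ioc p k, a i := by
  by_cases h : p ≤ k
  · have : Finset.Ioc (p - 1) k = insert p (Finset.Ioc p k) := by
      ext i; simp; omega
    rw [this, Finset.sum_insert (by simp)]
  · rw [Finset.Ioc_eq_empty (by omega), Finset.Ioc_eq_empty (by omega), ha p (by omega)]
    simp

theorem aux_recB {R : Type*} [CommRing R] (k : ℤ) (a : ℤ → R)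
    (ha : ∀ i, i < -k → a i = 0) (p : ℤ) :
    ∑ i ∈ Finset.Icc (-k) p, a i = a p + ∑ i ∈ Finset.Icc (-k) (p - 1), a i := by
  by_cases h : -k ≤ p
  · have : Finset.Icc (-k) p = insert p (Finset.Icc (-k) (p - 1)) := by
      ext i; simp; omega
    rw [this, Finset.sum_insert (by simp)]
  · rw [Finset.Icc_eq_empty (by omega), Finset.Icc_eq_empty (by omega), ha p (by omega)]
    simp

/-- If `A` is supported in powers `≤ k`, `B` in powers `≥ −k` (`k ≥ 1`), the adjoint
relation `A*∘(Λ−Λ⁻¹) = (Λ−Λ⁻¹)∘B` holds, and `E := Δ∘A∘ι_{Λ⁻¹}Δ⁻¹`,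
`F := Δ∘B∘ι_{Λ}Δ⁻¹`, then
`E_{[0]} + F_{[0]} = 2·((E_{≥0})* − (F_{<0})*)|_{Λ=1}`, i.e. for every `n`,
`E_0(n) + F_0(n) = 2(∑_{i≥0} E_i(n−i) − ∑_{i<0} F_i(n−i))`. -/
theorem stmt6 {R : Type*} [CommRing R] (k : ℤ) (hk : 1 ≤ k) (A B : ℤ → ℤ → R)
    (hA : ∀ i : ℤ, k < i → ∀ n : ℤ, A i n = 0)
    (hB : ∀ i : ℤ, i < -k → ∀ n : ℤ, B i n = 0)
    (hadj : BKP.comp (BKP.adj A) BKP.lam = BKP.comp BKP.lam B)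
    (E F : ℤ → ℤ → R)
    (hE : E = BKP.comp deltaOp (BKP.comp A iotaNegInvDelta))
    (hF : F = BKP.comp deltaOp (BKP.comp B iotaPosInvDelta)) :
    ∀ n : ℤ,
      E 0 n + F 0 n =
        2 * ((∑ᶠ i : ℤ, BKP.truncGe 0 E i (n - i)) -
          ∑ᶠ i : ℤ, BKP.truncLt 0 F i (n - i)) := by
  intro n
  obtain ⟨U, hUdef⟩ : ∃ U : ℤ → ℤ → R, ∀ t m, U t m = ∑ i ∈ Finset.Ioc (t - 1) k, A i m :=
    ⟨_, fun _ _ => rfl⟩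
  obtain ⟨W, hWdef⟩ : ∃ W : ℤ → ℤ → R, ∀ t m, W t m = ∑ i ∈ Finset.Icc (-k) (-t), B i m :=
    ⟨_, fun _ _ => rfl⟩
  have hU0 : ∀ t, k < t → ∀ m, U t m = 0 := by
    intro t ht m
    rw [hUdef, Finset.Ioc_eq_empty (by omega), Finset.sum_empty]
  have hW0 : ∀ t, k < t → ∀ m, W t m = 0 := by
    intro t ht m
    rw [hWdef, Finset.Icc_eq_empty (by omega), Finset.sum_empty]
  have hU1 : ∀ t m, U t m = A t m + U (t + 1) m := by
    intro t m
    rw [hUdef, hUdef, aux_recA k (fun i => A i m) (fun i hi => hA i hi m)]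
    simp
  have hW1 : ∀ t m, W t m = B (-t) m + W (t + 1) m := by
    intro t m
    rw [hWdef, hWdef, aux_recB k (fun i => B i m) (fun i hi => hB i hi m),
      show -(t + 1) = -t - 1 by ring]
  have hEE : ∀ p m, E p m = U p (m + 1) - U (p + 1) m := by
    intro p m
    rw [hE, aux_delta, aux_iotaN k A hA, aux_iotaN k A hA, hUdef, hUdef]
    simp
  have hFF : ∀ p m, F p m = W (-p) m - W (1 - p) (m + 1) := by
    intro p m
    rw [hF, aux_delta, aux_iotaP k B hB, aux_iotaP k B hB, hWdef, hWdef,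
      show -(1 - p) = p - 1 by ring, neg_neg]
    ring
  have hrel : ∀ t m, A t (m - t) - A (t + 2) (m - t - 2) = B (-t) (m - 1) - B (-t - 2) (m + 1) := by
    intro t m
    have h := congrFun (congrFun hadj (-t - 1)) m
    rw [aux_lamL, aux_lamR] at h
    simp only [BKP.adj] at h
    rw [show -(-t - 1 - 1) = t + 2 by ring, show -(-t - 1 + 1) = t by ring,
      show m + (-t - 1 - 1) = m - t - 2 by ring, show m + (-t - 1 + 1) = m - t by ring,
      show -t - 1 - 1 = -t - 2 by ring, show -t - 1 + 1 = -t by ring] at h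
    linear_combination -h
  have hVex : ∀ m, ∃ V : ℤ → R, (∀ t, k < t → V t = 0) ∧ ∀ t, V t = B (-t) m + V (t + 2) :=
    fun m => aux_V k (fun t => B (-t) m) (fun i hi => hB _ (by omega) m)
  choose V hV0 hV1 using hVex
  have hWV : ∀ t, ∀ m, W t m = V m t + V m (t + 1) := by
    apply aux_down k
    · intro t ht m
      rw [hW0 t ht, hV0 m t ht, hV0 m (t + 1) (by omega), add_zero]
    · intro t ih _ m
      rw [hW1, ih, hV1 m t, show t + 1 + 1 = t + 2 by ring]
      ring
  have hAV : ∀ t, ∀ m, A t (m - t) = V (m - 1) t - V (m + 1) (t + 2) := by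
    apply aux_down k
    · intro t ht m
      rw [hA t ht, hV0 _ t ht, hV0 _ (t + 2) (by omega), sub_zero]
    · intro t _ ih m
      have h1 := ih m
      have h2 := hrel t m
      have h3 := hV1 (m - 1) t
      have h4 := hV1 (m + 1) (t + 2)
      rw [show m - (t + 2) = m - t - 2 by ring] at h1
      rw [show -(t + 2) = -t - 2 by ring] at h4
      linear_combination h1 + h2 - h3 + h4
  have hUV : ∀ t, ∀ m, U t (m + 1) = V (m + t) t + V (m + t + 1) (t + 1) := by
    apply aux_down k
    · intro t ht m
      rw [hU0 t ht, hV0 _ t ht, hV0 _ (t + 1) (by omega), add_zero]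
    · intro t ih _ m
      have h1 := ih m
      have h2 := hAV t (m + t + 1)
      rw [show m + t + 1 - t = m + 1 by ring, show m + t + 1 - 1 = m + t by ring] at h2
      rw [show m + (t + 1) = m + t + 1 by ring, show t + 1 + 1 = t + 2 by ring] at h1
      rw [hU1, h1, h2]
      ring
  have hsE : ∑ᶠ i : ℤ, BKP.truncGe 0 E i (n - i) = U 0 (n + 1) := by
    have h := aux_tele k (fun i => U i (n - i + 1)) (fun i hi => hU0 i hi _)
    simp only [sub_zero] at h
    rw [← h]
    apply finsum_congr
    intro i
    simp only [BKP.truncGe]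
    rw [hEE, show n - (i + 1) + 1 = n - i by ring]
  have hsF : ∑ᶠ i : ℤ, BKP.truncLt 0 F i (n - i) = W 1 (n + 1) := by
    have h := aux_tele k (fun i => W (i + 1) (n + 1 + i)) (fun i hi => hW0 _ (by omega) _)
    simp only [add_zero, zero_add] at h
    rw [← h, ← finsum_comp_equiv (Equiv.subLeft (-1 : ℤ))]
    apply finsum_congr
    intro i
    simp only [BKP.truncLt, Equiv.subLeft_apply]
    rw [hFF]
    by_cases hi : 0 ≤ i
    · rw [if_pos hi, if_pos (by omega), show -(-1 - i) = i + 1 by ring,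
        show 1 - (-1 - i) = i + 1 + 1 by ring, show n - (-1 - i) = n + 1 + i by ring,
        show n + 1 + (i + 1) = n + 1 + i + 1 by ring]
    · rw [if_neg hi, if_neg (by omega)]
  rw [hsE, hsF, hEE, hFF]
  have h1 := hUV 0 n
  have h2 := hUV 1 (n - 1)
  have h3 := hWV 0 n
  have h4 := hWV 1 (n + 1)
  simp only [sub_add_cancel, add_zero, zero_add, neg_zero, sub_zero] at *
  rw [show (1 : ℤ) + 1 = 2 by norm_num] at *
  linear_combination h3 + h4 - h1 - h2
end

section
/- Let R be a commutative ring. Let L⁺ be the pseudo-difference operator L⁺ = ∑_{j=−1}^{∞} u⁺_j(n) Λ^{−j} (coefficient of Λ^i equal to u⁺_{−i}(n) for i ≤ 1, zero for i > 1) and L⁻ = ∑_{j=−1}^{∞} u⁻_j(n) Λ^{j} (coefficient of Λ^i equal to u⁻_i(n) for i ≥ −1, zero for i < −1), where u⁺_j, u⁻_j : ℤ → R. Assume the large BKP constraint (L⁺)*∘(Λ−Λ⁻¹) = (Λ−Λ⁻¹)∘L⁻ (coefficientwise). Then for all n ∈ ℤ: u⁻_{−1}(n) = u⁺_{−1}(n);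 u⁻_0(n) = u⁺_0(n+1); and for every j ≥ 1, u⁻_j(n−j) − u⁻_{j−2}(n−j+2) = u⁺_j(n+1) − u⁺_{j−2}(n−1). -/
/-- For large BKP Lax operators `L⁺ = ∑_{j=−1}^{∞} u⁺_j(n)Λ^{−j}` and
`L⁻ = ∑_{j=−1}^{∞} u⁻_j(n)Λ^{j}` satisfying the constraint
`(L⁺)*∘(Λ−Λ⁻¹) = (Λ−Λ⁻¹)∘L⁻`, the coefficients of `L⁻` are expressed through those
of `L⁺`: `u⁻_{−1}(n) = u⁺_{−1}(n)`, `u⁻_0(n) = u⁺_0(n+1)`, and for `j ≥ 1`,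
`u⁻_j(n−j) − u⁻_{j−2}(n−j+2) = u⁺_j(n+1) − u⁺_{j−2}(n−1)`. -/
theorem stmt7 {R : Type*} [CommRing R] (up um : ℤ → ℤ → R) (Lp Lm : ℤ → ℤ → R)
    (hLp : ∀ i n : ℤ, Lp i n = if i ≤ 1 then up (-i) n else 0)
    (hLm : ∀ i n : ℤ, Lm i n = if -1 ≤ i then um i n else 0)
    (hcon : BKP.comp (BKP.adj Lp) BKP.lam = BKP.comp BKP.lam Lm) :
    ∀ n : ℤ,
      um (-1) n = up (-1) n ∧
      um 0 n = up 0 (n + 1) ∧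
      ∀ j : ℤ, 1 ≤ j →
        um j (n - j) - um (j - 2) (n - j + 2) = up j (n + 1) - up (j - 2) (n - 1) := by
  have key : ∀ j m : ℤ, Lp (-(j-2)) (m + (j-2)) - Lp (-j) (m + j) = Lm (j-2) (m+1) - Lm j (m-1) := by
    intro j m
    have h := congrFun (congrFun hcon (j-1)) m
    unfold BKP.comp BKP.adj BKP.lam at h
    rw [finsum_eq_sum_of_support_subset (s := {j-2, j}), finsum_eq_sum_of_support_subset (s := {1, -1}),
      Finset.sum_pair (by omega), Finset.sum_pair (by omega)] at h
    · have e1 : j - 1 - (j - 2) = 1 := by ring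
      have e2 : j - 1 - j = -1 := by ring
      have e3 : j - 1 - 1 = j - 2 := by ring
      have e4 : j - 1 - -1 = j := by ring
      rw [e1, e2, e3, e4] at h
      norm_num at h
      simpa [sub_eq_add_neg] using h
    · intro i hi
      by_contra hc
      simp at hc
      simp [hc.1, hc.2] at hi
    · intro i hi
      by_contra hc
      simp at hc
      have h1 : ¬ (j - 1 - i = 1) := by omega
      have h2 : ¬ (j - 1 - i = -1) := by omega
      simp [h1, h2] at hi
  intro n
  refine ⟨?_, ?_, ?_⟩
  · have h := key (-1) (n+1)
    simp [hLp, hLm] at h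
    exact h.symm
  · have h := key 0 (n+1)
    simp [hLp, hLm] at h
    exact h.symm
  · intro j hj
    have h := key j (n-j+1)
    have e1 : n - j + 1 + (j - 2) = n - 1 := by ring
    have e2 : n - j + 1 + j = n + 1 := by ring
    have e3 : n - j + 1 + 1 = n - j + 2 := by ring
    have e4 : n - j + 1 - 1 = n - j := by ring
    rw [e1, e2, e3, e4, hLp, hLp, hLm, hLm, if_pos (by omega), if_pos (by omega),
      if_pos (by omega), if_pos (by omega), neg_neg, neg_neg] at h
    linear_combination h
end

section
/- Let K be a field and let u_j : ℤ → K for j ≥ −1 be given with u_{−1}(n) ≠ 0 for every n ∈ ℤ. Then there exist b_j : ℤ → K for j ≥ 0 with b_0(n) ≠ 0 for every n, such that for all j ≥ 0 and n ∈ ℤ: ∑_{l=0}^{j−1} u_{j−l−1}(n)·b_l(n−j+l+1) + u_{−1}(n)·b_j(n+1) = b_j(n). Equivalently, the lower-triangular dressing operator S⁺ = ∑_{j=0}^{∞} b_j(n)Λ^{−j} with invertible leading coefficient b_0 satisfies the intertwining identity L⁺∘S⁺ = S⁺∘Λ, where L⁺ = ∑_{j=−1}^{∞} u_j(n)Λ^{−j}.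 -/
def solUp {K : Type*} [Field K] (a f : ℤ → K) : ℕ → K
  | 0 => 1
  | k + 1 => (solUp a f k - f k) / a k

def solDown {K : Type*} [Field K] (a f : ℤ → K) : ℕ → K
  | 0 => f (Int.negSucc 0) + a (Int.negSucc 0) * 1
  | k + 1 => f (Int.negSucc (k + 1)) + a (Int.negSucc (k + 1)) * solDown a f k

def sol {K : Type*} [Field K] (a f : ℤ → K) : ℤ → K
  | Int.ofNat k => solUp a f k
  | Int.negSucc k => solDown a f k

theorem sol_spec {K : Type*} [Field K] (a f : ℤ → K) (ha : ∀ n, a n ≠ 0) (n : ℤ) :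
    f n + a n * sol a f (n + 1) = sol a f n := by
  match n with
  | Int.ofNat k =>
    change f k + a k * ((solUp a f k - f k) / a k) = solUp a f k
    have := ha k
    field_simp
    ring
  | Int.negSucc 0 => rfl
  | Int.negSucc (k + 1) => rfl

theorem sol_ne {K : Type*} [Field K] (a f : ℤ → K) (ha : ∀ n, a n ≠ 0) (hf : ∀ n, f n = 0)
    (n : ℤ) : sol a f n ≠ 0 := by
  match n with
  | Int.ofNat k =>
    change solUp a f k ≠ 0
    induction k with
    | zero => simp [solUp]
    | succ k ih => simp [solUp, hf, ha, ih]
  | Int.negSucc k =>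
    change solDown a f k ≠ 0
    induction k with
    | zero => simp [solDown, hf, ha]
    | succ k ih => simp [solDown, hf, ha, ih]

def dressB {K : Type*} [Field K] (u : ℤ → ℤ → K) (j : ℕ) : ℤ → K :=
  sol (u (-1)) (fun n => ∑ l : Fin j,
    u ((j : ℤ) - ((l : ℕ) : ℤ) - 1) n * dressB u l (n - (j : ℤ) + ((l : ℕ) : ℤ) + 1))
termination_by j
decreasing_by exact l.2

/-- Existence of the dressing operator `S⁺ = ∑_{j≥0} b_j(n)Λ^{−j}` (with invertible
leading coefficient) for a given large BKP Lax operator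
`L⁺ = ∑_{j=−1}^{∞} u_j(n)Λ^{−j}` over a field, with `u_{−1}` nowhere zero:
the coefficient recursion
`∑_{l=0}^{j−1} u_{j−l−1}(n)·b_l(n−j+l+1) + u_{−1}(n)·b_j(n+1) = b_j(n)` — the
coefficient form of `L⁺∘S⁺ = S⁺∘Λ` — has a solution with `b_0(n) ≠ 0` for all `n`. -/
theorem stmt8 {K : Type*} [Field K] (u : ℤ → ℤ → K) (hu : ∀ n : ℤ, u (-1) n ≠ 0) :
    ∃ b : ℕ → ℤ → K, (∀ n : ℤ, b 0 n ≠ 0) ∧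
      ∀ (j : ℕ) (n : ℤ),
        (∑ l ∈ Finset.range j, u ((j : ℤ) - (l : ℤ) - 1) n * b l (n - (j : ℤ) + (l : ℤ) + 1)) +
          u (-1) n * b j (n + 1) = b j n := by
  refine ⟨dressB u, fun n => ?_, fun j n => ?_⟩
  · rw [dressB]
    exact sol_ne _ _ hu (fun n => by simp) n
  · conv_rhs => rw [dressB]
    rw [← sol_spec _ _ hu n, ← dressB, Finset.sum_range]
end

section
/- Let R be a commutative ring. For a = 1, 2 let S_a be lower-triangular pseudo-difference operators (coefficients of Λ^i vanish for i > 0) admitting two-sided lower-triangular inverses T_a (i.e. S_a∘T_a = T_a∘S_a = 1). Assume S₁ and S₂ dress the shift to the same Lax operator: S₁∘Λ∘T₁ = S₂∘Λ∘T₂. Then C := T₁∘S₂ commutes with Λ, C∘Λ = Λ∘C, and consequently every coefficient of C is independent of the site variable: C_i(n) = C_i(n+1) for all i, n ∈ ℤ. -/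
namespace BKP

theorem comp_eq_sum {R : Type*} [CommRing R] {C D : ℤ → ℤ → R} {a b : ℤ}
    (hC : ∀ i : ℤ, a < i → ∀ n : ℤ, C i n = 0)
    (hD : ∀ i : ℤ, b < i → ∀ n : ℤ, D i n = 0) (p n l u : ℤ) (hl : l ≤ p - b) (hu : a ≤ u) :
    comp C D p n = ∑ i ∈ Finset.Icc l u, C i n * D (p - i) (n + i) := by
  unfold comp
  apply finsum_eq_sum_of_support_subset
  intro i hi
  simp only [Function.mem_support] at hi
  simp only [Finset.coe_Icc, Set.mem_Icc]
  constructor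
  · by_contra h
    exact hi (by rw [hD _ (by omega), mul_zero])
  · by_contra h
    exact hi (by rw [hC _ (by omega), zero_mul])

theorem comp_bdd {R : Type*} [CommRing R] {C D : ℤ → ℤ → R} {a b : ℤ}
    (hC : ∀ i : ℤ, a < i → ∀ n : ℤ, C i n = 0)
    (hD : ∀ i : ℤ, b < i → ∀ n : ℤ, D i n = 0) :
    ∀ i : ℤ, a + b < i → ∀ n : ℤ, comp C D i n = 0 := by
  intro i hi n
  rw [comp_eq_sum hC hD i n (i - b) a le_rfl le_rfl, Finset.Icc_eq_empty (by omega)]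
  simp

theorem comp_assoc {R : Type*} [CommRing R] {C D E : ℤ → ℤ → R} {a b c : ℤ}
    (hC : ∀ i : ℤ, a < i → ∀ n : ℤ, C i n = 0)
    (hD : ∀ i : ℤ, b < i → ∀ n : ℤ, D i n = 0)
    (hE : ∀ i : ℤ, c < i → ∀ n : ℤ, E i n = 0) :
    comp (comp C D) E = comp C (comp D E) := by
  funext p n
  rw [comp_eq_sum (comp_bdd hC hD) hE p n (p - c) (a + b) le_rfl le_rfl,
    comp_eq_sum hC (comp_bdd hD hE) p n (p - (b + c)) a le_rfl le_rfl]
  have h1 : ∀ i ∈ Finset.Icc (p - c) (a + b), comp C D i n * E (p - i) (n + i) =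
      ∑ j ∈ Finset.Icc (p - (b + c)) a, C j n * D (i - j) (n + j) * E (p - i) (n + i) := by
    intro i hi
    rw [Finset.mem_Icc] at hi
    rw [comp_eq_sum hC hD i n (p - (b + c)) a (by omega) le_rfl, Finset.sum_mul]
  have h2 : ∀ j ∈ Finset.Icc (p - (b + c)) a, C j n * comp D E (p - j) (n + j) =
      ∑ i ∈ Finset.Icc (p - c) (a + b), C j n * D (i - j) (n + j) * E (p - i) (n + i) := by
    intro j hj
    rw [Finset.mem_Icc] at hj
    rw [comp_eq_sum hD hE (p - j) (n + j) (p - c - j) (a + b - j) (by omega) (by omega),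
      Finset.mul_sum]
    refine Finset.sum_bij' (fun k _ => k + j) (fun i _ => i - j) ?_ ?_ ?_ ?_ ?_
    · intro k hk; rw [Finset.mem_Icc] at *; omega
    · intro k hk; rw [Finset.mem_Icc] at *; omega
    · intro k _; simp
    · intro k _; simp
    · intro k _
      rw [show k + j - j = k by ring, show p - j - k = p - (k + j) by ring,
        show n + j + k = n + (k + j) by ring, mul_assoc]
  rw [Finset.sum_congr rfl h1, Finset.sum_congr rfl h2, Finset.sum_comm]

theorem shift_comp {R : Type*} [CommRing R] (m : ℤ) (C : ℤ → ℤ → R) (p n : ℤ) :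
    comp (shift m) C p n = C (p - m) (n + m) := by
  unfold comp shift
  rw [finsum_eq_single _ m (by intro i hi; simp [hi])]
  simp

theorem comp_shift {R : Type*} [CommRing R] (m : ℤ) (C : ℤ → ℤ → R) (p n : ℤ) :
    comp C (shift m) p n = C (p - m) n := by
  unfold comp shift
  rw [finsum_eq_single _ (p - m) (by
    intro i hi
    rw [if_neg (by omega), mul_zero])]
  simp

theorem shift_bdd {R : Type*} [CommRing R] (m : ℤ) :
    ∀ i : ℤ, m < i → ∀ n : ℤ, (shift m : ℤ → ℤ → R) i n = 0 := by
  intro i hi n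
  simp [shift, hi.ne']

end BKP

/-- Uniqueness part of the dressing proposition: if lower-triangular operators
`S₁, S₂` with two-sided lower-triangular inverses `T₁, T₂` dress the shift to the
same Lax operator, `S₁∘Λ∘T₁ = S₂∘Λ∘T₂`, then `C := T₁∘S₂` commutes with `Λ` and all
its coefficients are independent of the site variable. -/
theorem stmt9 {R : Type*} [CommRing R] (S₁ S₂ T₁ T₂ : ℤ → ℤ → R)
    (hS₁ : ∀ i : ℤ, 0 < i → ∀ n : ℤ, S₁ i n = 0)
    (hS₂ : ∀ i : ℤ, 0 < i → ∀ n : ℤ, S₂ i n = 0)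
    (hT₁ : ∀ i : ℤ, 0 < i → ∀ n : ℤ, T₁ i n = 0)
    (hT₂ : ∀ i : ℤ, 0 < i → ∀ n : ℤ, T₂ i n = 0)
    (hST₁ : BKP.comp S₁ T₁ = BKP.shift 0) (hTS₁ : BKP.comp T₁ S₁ = BKP.shift 0)
    (hST₂ : BKP.comp S₂ T₂ = BKP.shift 0) (hTS₂ : BKP.comp T₂ S₂ = BKP.shift 0)
    (hdress : BKP.comp S₁ (BKP.comp (BKP.shift 1) T₁)
      = BKP.comp S₂ (BKP.comp (BKP.shift 1) T₂)) :
    BKP.comp (BKP.comp T₁ S₂) (BKP.shift 1) = BKP.comp (BKP.shift 1) (BKP.comp T₁ S₂) ∧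
      ∀ i n : ℤ, BKP.comp T₁ S₂ i n = BKP.comp T₁ S₂ i (n + 1) := by
  have hΛ := BKP.shift_bdd (R := R) 1
  have key : BKP.comp (BKP.comp T₁ S₂) (BKP.shift 1)
      = BKP.comp (BKP.shift 1) (BKP.comp T₁ S₂) := by
    have e1 : BKP.comp S₂ (BKP.shift 1)
        = BKP.comp (BKP.comp S₂ (BKP.comp (BKP.shift 1) T₂)) S₂ := by
      rw [BKP.comp_assoc hS₂ (BKP.comp_bdd hΛ hT₂) hS₂, BKP.comp_assoc hΛ hT₂ hS₂, hTS₂]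
      congr 1
      funext p n
      rw [BKP.comp_shift, sub_zero]
    rw [BKP.comp_assoc hT₁ hS₂ hΛ, e1, ← hdress,
      BKP.comp_assoc hS₁ (BKP.comp_bdd hΛ hT₁) hS₂, BKP.comp_assoc hΛ hT₁ hS₂,
      ← BKP.comp_assoc hT₁ hS₁ (BKP.comp_bdd hΛ (BKP.comp_bdd hT₁ hS₂)), hTS₁]
    funext p n
    rw [BKP.shift_comp, sub_zero, add_zero]
  refine ⟨key, fun i n => ?_⟩
  have h := congrFun (congrFun key (i + 1)) n
  rw [BKP.comp_shift, BKP.shift_comp, add_sub_cancel_right] at h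
  exact h
end

section
/- Let R be a commutative ring. Let S⁺ and S⁻ be lower-triangular pseudo-difference operators (coefficients of Λ^i vanish for i > 0) admitting two-sided lower-triangular inverses T⁺, T⁻, and assume S⁺∘Λ⁻¹∘S⁻ = ι_{Λ⁻¹}(Λ−Λ⁻¹)⁻¹, where ι_{Λ⁻¹}(Λ−Λ⁻¹)⁻¹ denotes the operator with coefficient 1 at each power i = −1−2m (m ≥ 0) and 0 elsewhere. Define L⁺ := S⁺∘Λ∘T⁺, L⁻ := (S⁻)*∘Λ⁻¹∘(T⁻)*, and for k ≥ 1 define the flow generator B_k := ( P_{≥0} + (P*)_{<0} )∘(Λ−Λ⁻¹) with P := S⁺∘Λ^{k−1}∘S⁻. Then B_k is expressed through the Lax operators as B_k = ((L⁺)ᵏ)_{≥1} − ((L⁻)ᵏ)_{≤−1} − ( ((L⁺)ᵏ)_{≥1} − ((L⁻)ᵏ)_{≤−1} )|_{Λ=1}, where the last term is the multiplication operator by the (finite-sum) function n ↦ ∑_{i≥1} ((L⁺)ᵏ)_i(n) − ∑_{i≤−1} ((L⁻)ᵏ)_i(n). -/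
/-- `ι_{Λ⁻¹}(Λ−Λ⁻¹)⁻¹ = Λ⁻¹ + Λ⁻³ + Λ⁻⁵ + ⋯`: coefficient `1` at each power
`i = −1−2m` (`m ≥ 0`), `0` elsewhere. -/
def iotaInvLam {R : Type*} [CommRing R] : ℤ → ℤ → R :=
  fun i _ => if i ≤ -1 ∧ Odd i then 1 else 0

namespace BKPaux

open BKP

variable {R : Type*} [CommRing R]

def Below (a : ℤ) (C : ℤ → ℤ → R) : Prop := ∀ i : ℤ, a < i → ∀ n : ℤ, C i n = 0

theorem comp_eq_sum {a b : ℤ} {C D : ℤ → ℤ → R} (hC : Below a C) (hD : Below b D)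
    (p n L H : ℤ) (hL : L ≤ p - b) (hH : a ≤ H) :
    comp C D p n = ∑ i ∈ Finset.Icc L H, C i n * D (p - i) (n + i) := by
  unfold comp
  apply finsum_eq_sum_of_support_subset
  intro i hi
  rw [Function.mem_support] at hi
  rw [Finset.coe_Icc, Set.mem_Icc]
  constructor
  · by_contra h
    exact hi (by rw [hD (p - i) (by omega), mul_zero])
  · by_contra h
    exact hi (by rw [hC i (by omega), zero_mul])

theorem Below.comp {a b : ℤ} {C D : ℤ → ℤ → R} (hC : Below a C) (hD : Below b D) :
    Below (a + b) (comp C D) := by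
  intro p hp n
  rw [comp_eq_sum hC hD p n (p - b) a le_rfl le_rfl, Finset.Icc_eq_empty (by omega),
    Finset.sum_empty]

theorem comp_assoc {a b c : ℤ} {C D E : ℤ → ℤ → R} (hC : Below a C) (hD : Below b D)
    (hE : Below c E) : comp (comp C D) E = comp C (comp D E) := by
  funext p n
  rw [comp_eq_sum (hC.comp hD) hE p n (p - c) (a + b) le_rfl le_rfl,
    comp_eq_sum hC (hD.comp hE) p n (p - (b + c)) a le_rfl le_rfl]
  have h1 : ∀ i ∈ Finset.Icc (p - c) (a + b), comp C D i n * E (p - i) (n + i) =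
      ∑ j ∈ Finset.Icc (p - (b + c)) a, C j n * D (i - j) (n + j) * E (p - i) (n + i) := by
    intro i hi
    rw [Finset.mem_Icc] at hi
    rw [comp_eq_sum hC hD i n (p - (b + c)) a (by omega) le_rfl, Finset.sum_mul]
  have h2 : ∀ j ∈ Finset.Icc (p - (b + c)) a, C j n * comp D E (p - j) (n + j) =
      ∑ i ∈ Finset.Icc (p - c) (a + b), C j n * D (i - j) (n + j) * E (p - i) (n + i) := by
    intro j hj
    rw [Finset.mem_Icc] at hj
    rw [comp_eq_sum hD hE (p - j) (n + j) (p - c - j) (a + b - j) (by omega) (by omega),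
      Finset.mul_sum]
    refine Finset.sum_bij' (fun l _ => l + j) (fun i _ => i - j) ?_ ?_ ?_ ?_ ?_
    · intro l hl; rw [Finset.mem_Icc] at *; omega
    · intro l hl; rw [Finset.mem_Icc] at *; omega
    · intro l hl; simp
    · intro l hl; simp
    · intro l hl
      have e1 : l + j - j = l := by ring
      have e2 : p - (l + j) = p - j - l := by ring
      have e3 : n + (l + j) = n + j + l := by ring
      rw [e1, e2, e3]; ring
  rw [Finset.sum_congr rfl h1, Finset.sum_congr rfl h2, Finset.sum_comm]

theorem shift_comp (m : ℤ) (C : ℤ → ℤ → R) (p n : ℤ) :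
    comp (shift m) C p n = C (p - m) (n + m) := by
  unfold comp shift
  rw [finsum_eq_single _ m]
  · simp
  · intro x hx; simp [hx]

theorem comp_shift (m : ℤ) (C : ℤ → ℤ → R) (p n : ℤ) :
    comp C (shift m) p n = C (p - m) n := by
  unfold comp shift
  rw [finsum_eq_single _ (p - m)]
  · simp
  · intro x hx
    rw [if_neg (by omega), mul_zero]

theorem shift_below (m : ℤ) : Below m (shift m : ℤ → ℤ → R) := by
  intro i hi n
  simp [shift, ne_of_gt hi]

theorem shift_shift (a b : ℤ) :
    comp (shift a) (shift b) = (shift (a + b) : ℤ → ℤ → R) := by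
  funext p n
  rw [shift_comp]
  simp only [shift]
  congr 1
  apply propext
  omega

theorem comp_lam (C : ℤ → ℤ → R) (p n : ℤ) :
    comp C lam p n = C (p - 1) n - C (p + 1) n := by
  unfold comp lam
  rw [finsum_eq_sum_of_support_subset (s := {p - 1, p + 1})]
  · rw [Finset.sum_pair (by omega)]
    simp [sub_eq_add_neg]
  · intro i hi
    rw [Function.mem_support] at hi
    simp only [Finset.coe_insert, Finset.coe_singleton, Set.mem_insert_iff,
      Set.mem_singleton_iff]
    by_contra h
    exact hi (by rw [if_neg (by omega), if_neg (by omega), mul_zero])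

theorem lam_comp (C : ℤ → ℤ → R) (p n : ℤ) :
    comp lam C p n = C (p - 1) (n + 1) - C (p + 1) (n - 1) := by
  unfold comp lam
  rw [finsum_eq_sum_of_support_subset (s := {1, -1})]
  · rw [Finset.sum_pair (by omega)]
    simp [sub_eq_add_neg]
  · intro i hi
    rw [Function.mem_support] at hi
    simp only [Finset.coe_insert, Finset.coe_singleton, Set.mem_insert_iff,
      Set.mem_singleton_iff]
    by_contra h
    exact hi (by rw [if_neg (by omega), if_neg (by omega), zero_mul])

theorem lam_below : Below 1 (lam : ℤ → ℤ → R) := by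
  intro i hi n
  simp only [lam]
  rw [if_neg (by omega), if_neg (by omega)]

theorem iota_below : Below (-1) (iotaInvLam : ℤ → ℤ → R) := by
  intro i hi n
  simp only [iotaInvLam]
  rw [if_neg (by omega)]

theorem iota_diff (p : ℤ) (n m : ℤ) :
    (iotaInvLam (p - 1) n - iotaInvLam (p + 1) m : R) = if p = 0 then 1 else 0 := by
  simp only [iotaInvLam, Int.odd_iff]
  by_cases h0 : p = 0
  · subst h0; simp
  · rw [if_neg h0]
    by_cases h : p - 1 ≤ -1 ∧ (p - 1) % 2 = 1
    · rw [if_pos h, if_pos (by omega), sub_self]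
    · rw [if_neg h, if_neg (by omega), sub_self]

theorem iota_lam : comp iotaInvLam lam = (shift 0 : ℤ → ℤ → R) := by
  funext p n
  rw [comp_lam, iota_diff]; rfl

theorem lam_iota : comp lam iotaInvLam = (shift 0 : ℤ → ℤ → R) := by
  funext p n
  rw [lam_comp, iota_diff]; rfl

theorem adj_comp (C D : ℤ → ℤ → R) : adj (comp C D) = comp (adj D) (adj C) := by
  funext p n
  simp only [adj, comp]
  rw [← finsum_comp_equiv (Equiv.subRight p)]
  apply finsum_congr
  intro j
  simp only [Equiv.subRight_apply]
  have e1 : -p - (j - p) = -j := by ring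
  have e2 : n + p + (j - p) = n + j := by ring
  have e3 : -(p - j) = j - p := by ring
  have e4 : n + j + (p - j) = n + p := by ring
  rw [e1, e2, e3, e4, mul_comm]

theorem adj_shift (m : ℤ) : adj (shift m) = (shift (-m) : ℤ → ℤ → R) := by
  funext p n
  simp only [adj, shift]
  congr 1
  apply propext
  omega

/-- operators bounded above -/
def Op (R : Type*) [CommRing R] := {C : ℤ → ℤ → R // ∃ a, Below a C}

noncomputable instance : Monoid (Op R) where
  mul C D := ⟨comp C.1 D.1, by
    obtain ⟨a, ha⟩ := C.2
    obtain ⟨b, hb⟩ := D.2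
    exact ⟨_, ha.comp hb⟩⟩
  one := ⟨shift 0, 0, shift_below 0⟩
  mul_assoc C D E := by
    obtain ⟨a, ha⟩ := C.2
    obtain ⟨b, hb⟩ := D.2
    obtain ⟨c, hc⟩ := E.2
    exact Subtype.ext (comp_assoc ha hb hc)
  one_mul C := Subtype.ext (by funext p n; exact (shift_comp 0 C.1 p n).trans (by simp))
  mul_one C := Subtype.ext (by funext p n; exact (comp_shift 0 C.1 p n).trans (by simp))

theorem val_mul (C D : Op R) : (C * D).1 = comp C.1 D.1 := rfl

theorem val_one : (1 : Op R).1 = shift 0 := rfl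

theorem val_pow (C : Op R) (k : ℕ) : (C ^ k).1 = powOp C.1 k := by
  induction k with
  | zero => rw [pow_zero]; rfl
  | succ k ih => rw [pow_succ', val_mul, ih]; rfl

theorem adj_pow (C : Op R) (k : ℕ) : adj (C ^ k).1 = powOp (adj C.1) k := by
  induction k with
  | zero => rw [pow_zero, val_one, adj_shift]; rfl
  | succ k ih => rw [pow_succ, val_mul, adj_comp, ih]; rfl

theorem conj_pow {M : Type*} [Monoid M] (S T X : M) (h : T * S = 1) (h' : S * T = 1) (k : ℕ) :
    (S * (X * T)) ^ k = S * (X ^ k * T) := by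
  induction k with
  | zero => simp [h']
  | succ k ih =>
    calc (S * (X * T)) ^ (k + 1) = S * (X ^ k * ((T * S) * (X * T))) := by
          rw [pow_succ, ih]; simp only [mul_assoc]
      _ = _ := by rw [h, one_mul, pow_succ]; simp only [mul_assoc]

/-- shift as a bounded operator -/
def sh (m : ℤ) : Op R := ⟨shift m, m, shift_below m⟩

theorem sh_mul (a b : ℤ) : (sh a * sh b : Op R) = sh (a + b) := Subtype.ext (shift_shift a b)

theorem sh_pow (k : ℕ) : (sh 1 ^ k : Op R) = sh k := by
  induction k with
  | zero => rw [pow_zero]; rfl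
  | succ k ih => rw [pow_succ, ih, sh_mul]; norm_num

theorem tele (f : ℤ → R) (N : ℤ) (hf : ∀ i, N < i → f i = 0) :
    ∑ᶠ i : ℤ, (if 1 ≤ i then f (i - 1) - f (i + 1) else 0) = f 0 + f 1 := by
  have key : ∀ m : ℕ, ∑ i ∈ Finset.range m, (f i - f (i + 2)) = f 0 + f 1 - f m - f (m + 1) := by
    intro m
    induction m with
    | zero => simp
    | succ m ih =>
      rw [Finset.sum_range_succ, ih]
      push_cast
      rw [show (m : ℤ) + 1 + 1 = m + 2 by ring]
      ring
  rw [finsum_eq_sum_of_support_subset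
    (s := (Finset.range (N + 1).toNat).image (fun j : ℕ => (j : ℤ) + 1))]
  · rw [Finset.sum_image (by intro a _ b _ h; simpa using h)]
    have := key (N + 1).toNat
    rw [hf ((N + 1).toNat : ℤ) (by omega), hf (((N + 1).toNat : ℤ) + 1) (by omega)] at this
    rw [sub_zero, sub_zero] at this
    rw [← this]
    apply Finset.sum_congr rfl
    intro j _
    rw [if_pos (by omega)]
    congr 2 <;> ring
  · intro i hi
    rw [Function.mem_support] at hi
    by_cases h1 : 1 ≤ i
    · rw [if_pos h1] at hi
      have : i - 1 ≤ N := by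
        by_contra h
        exact hi (by rw [hf _ (by omega), hf _ (by omega), sub_zero])
      simp only [Finset.coe_image, Set.mem_image, Finset.mem_coe, Finset.mem_range]
      exact ⟨(i - 1).toNat, by omega, by omega⟩
    · exact absurd (if_neg h1) hi

theorem tele' (f : ℤ → R) (N : ℤ) (hf : ∀ i, i < N → f i = 0) :
    ∑ᶠ i : ℤ, (if i ≤ -1 then f (i + 1) - f (i - 1) else 0) = f 0 + f (-1) := by
  have h := tele (fun i => f (-i)) (-N) (fun i hi => hf _ (by omega))
  rw [← finsum_comp_equiv (Equiv.neg ℤ)]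
  simp only [neg_zero] at h
  rw [← h]
  apply finsum_congr
  intro i
  simp only [Equiv.neg_apply]
  by_cases h1 : 1 ≤ i
  · rw [if_pos h1, if_pos (by omega)]
    congr 2 <;> ring
  · rw [if_neg h1, if_neg (by omega)]

end BKPaux

/-- The flow generator `B_k := (P_{≥0} + (P*)_{<0})∘(Λ−Λ⁻¹)` with
`P := S⁺∘Λ^{k−1}∘S⁻` of the large BKP hierarchy is expressed through the Lax
operators `L⁺ := S⁺∘Λ∘T⁺`, `L⁻ := (S⁻)*∘Λ⁻¹∘(T⁻)*` as
`B_k = ((L⁺)ᵏ)_{≥1} − ((L⁻)ᵏ)_{≤−1} − (((L⁺)ᵏ)_{≥1} − ((L⁻)ᵏ)_{≤−1})|_{Λ=1}`,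
the last term being the multiplication operator by
`n ↦ ∑_{i≥1} ((L⁺)ᵏ)_i(n) − ∑_{i≤−1} ((L⁻)ᵏ)_i(n)`. -/
theorem stmt11 {R : Type*} [CommRing R] (Sp Sm Tp Tm : ℤ → ℤ → R)
    (hSp : ∀ i : ℤ, 0 < i → ∀ n : ℤ, Sp i n = 0)
    (hSm : ∀ i : ℤ, 0 < i → ∀ n : ℤ, Sm i n = 0)
    (hTp : ∀ i : ℤ, 0 < i → ∀ n : ℤ, Tp i n = 0)
    (hTm : ∀ i : ℤ, 0 < i → ∀ n : ℤ, Tm i n = 0)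
    (hSTp : BKP.comp Sp Tp = BKP.shift 0) (hTSp : BKP.comp Tp Sp = BKP.shift 0)
    (hSTm : BKP.comp Sm Tm = BKP.shift 0) (hTSm : BKP.comp Tm Sm = BKP.shift 0)
    (hfact : BKP.comp Sp (BKP.comp (BKP.shift (-1)) Sm) = iotaInvLam)
    (Lp Lm : ℤ → ℤ → R)
    (hLp : Lp = BKP.comp Sp (BKP.comp (BKP.shift 1) Tp))
    (hLm : Lm = BKP.comp (BKP.adj Sm) (BKP.comp (BKP.shift (-1)) (BKP.adj Tm)))
    (k : ℕ) (hk : 1 ≤ k) (P Bk : ℤ → ℤ → R)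
    (hP : P = BKP.comp Sp (BKP.comp (BKP.shift ((k : ℤ) - 1)) Sm))
    (hBk : Bk = BKP.comp
      (fun i n => BKP.truncGe 0 P i n + BKP.truncLt 0 (BKP.adj P) i n) BKP.lam) :
    Bk = fun i n =>
      BKP.truncGe 1 (BKP.powOp Lp k) i n - BKP.truncLe (-1) (BKP.powOp Lm k) i n -
        (if i = 0 then
          (∑ᶠ i' : ℤ, BKP.truncGe 1 (BKP.powOp Lp k) i' n) -
            ∑ᶠ i' : ℤ, BKP.truncLe (-1) (BKP.powOp Lm k) i' n
        else 0) := by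
  classical
  let sp : BKPaux.Op R := ⟨Sp, 0, hSp⟩
  let sm : BKPaux.Op R := ⟨Sm, 0, hSm⟩
  let tp : BKPaux.Op R := ⟨Tp, 0, hTp⟩
  let tm : BKPaux.Op R := ⟨Tm, 0, hTm⟩
  let io : BKPaux.Op R := ⟨iotaInvLam, _, BKPaux.iota_below⟩
  let la : BKPaux.Op R := ⟨BKP.lam, _, BKPaux.lam_below⟩
  let p : BKPaux.Op R := sp * (BKPaux.sh ((k : ℤ) - 1) * sm)
  have hp : p.1 = P := hP.symm
  have h1 : sp * tp = 1 := Subtype.ext hSTp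
  have h2 : tp * sp = 1 := Subtype.ext hTSp
  have h3 : sm * tm = 1 := Subtype.ext hSTm
  have h4 : tm * sm = 1 := Subtype.ext hTSm
  have h5 : sp * (BKPaux.sh (-1) * sm) = io := Subtype.ext hfact
  have h6 : io * la = 1 := Subtype.ext BKPaux.iota_lam
  have h7 : la * io = 1 := Subtype.ext BKPaux.lam_iota
  have hA : p * la = (sp * (BKPaux.sh 1 * tp)) ^ k := by
    rw [BKPaux.conj_pow _ _ _ h2 h1, BKPaux.sh_pow]
    have : p = sp * (BKPaux.sh k * tp) * io := by
      rw [← h5]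
      calc p = sp * ((BKPaux.sh k * BKPaux.sh (-1)) * sm) := by
            rw [BKPaux.sh_mul]; rfl
        _ = sp * (BKPaux.sh k * ((tp * sp) * (BKPaux.sh (-1) * sm))) := by
            rw [h2, one_mul, mul_assoc]
        _ = _ := by simp only [mul_assoc]
    rw [this, mul_assoc, h6, mul_one]
  have hD : la * p = (tm * (BKPaux.sh 1 * sm)) ^ k := by
    rw [BKPaux.conj_pow _ _ _ h3 h4, BKPaux.sh_pow]
    have : p = io * (tm * (BKPaux.sh k * sm)) := by
      rw [← h5]
      calc p = sp * ((BKPaux.sh (-1) * BKPaux.sh k) * sm) := by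
            rw [BKPaux.sh_mul, neg_add_eq_sub]
        _ = sp * (BKPaux.sh (-1) * ((sm * tm) * (BKPaux.sh k * sm))) := by
            rw [h3, one_mul, mul_assoc]
        _ = _ := by simp only [mul_assoc]
    rw [this, ← mul_assoc, h7, one_mul]
  have hAv : ∀ i n, BKP.powOp Lp k i n = P (i - 1) n - P (i + 1) n := by
    intro i n
    have e : BKP.powOp Lp k = ((sp * (BKPaux.sh 1 * tp)) ^ k).1 := by
      rw [BKPaux.val_pow, hLp]; rfl
    rw [e, ← hA, BKPaux.val_mul, hp]
    exact BKPaux.comp_lam P i n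
  have hDv : ∀ i n, BKP.powOp Lm k i n = BKP.adj P (i + 1) n - BKP.adj P (i - 1) n := by
    intro i n
    have e0 : Lm = BKP.adj (tm * (BKPaux.sh 1 * sm)).1 := by
      rw [← mul_assoc, BKPaux.val_mul, BKPaux.val_mul, BKPaux.adj_comp, BKPaux.adj_comp, hLm]
      change _ = BKP.comp _ (BKP.comp (BKP.adj (BKP.shift 1)) _)
      rw [BKPaux.adj_shift]
    rw [e0, ← BKPaux.adj_pow, ← hD, BKPaux.val_mul, hp]
    change BKP.comp BKP.lam P (-i) (n + i) = _
    rw [BKPaux.lam_comp]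
    simp only [BKP.adj]
    congr 2 <;> ring
  obtain ⟨N, hN⟩ : ∃ N, BKPaux.Below N P := hp ▸ p.2
  have hs1 : ∀ n, ∑ᶠ i' : ℤ, BKP.truncGe 1 (BKP.powOp Lp k) i' n = P 0 n + P 1 n := by
    intro n
    rw [← BKPaux.tele (fun i => P i n) N (fun i hi => hN i hi n)]
    apply finsum_congr
    intro i
    simp only [BKP.truncGe, hAv]
  have hs2 : ∀ n, ∑ᶠ i' : ℤ, BKP.truncLe (-1) (BKP.powOp Lm k) i' n =
      BKP.adj P 0 n + BKP.adj P (-1) n := by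
    intro n
    rw [← BKPaux.tele' (fun i => BKP.adj P i n) (-N) (fun i hi => hN _ (by omega) _)]
    apply finsum_congr
    intro i
    simp only [BKP.truncLe, hDv]
  have hadj0 : ∀ n, BKP.adj P 0 n = P 0 n := by
    intro n; simp [BKP.adj]
  subst hBk
  funext i n
  rw [BKPaux.comp_lam, hs1, hs2, hadj0]
  simp only [BKP.truncGe, BKP.truncLe, BKP.truncLt, hAv, hDv]
  rcases lt_trichotomy i 0 with hi | hi | hi
  · rw [if_neg (by omega : ¬ (0 ≤ i - 1)), if_pos (by omega : i - 1 < 0),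
      if_neg (by omega : ¬ (1 ≤ i)), if_pos (by omega : i ≤ -1), if_neg (by omega : ¬ i = 0)]
    by_cases h : i = -1
    · subst h
      norm_num [hadj0]
    · rw [if_neg (by omega : ¬ (0 ≤ i + 1)), if_pos (by omega : i + 1 < 0)]
      ring
  · subst hi
    norm_num
  · rw [if_pos (by omega : 0 ≤ i - 1), if_neg (by omega : ¬ (i - 1 < 0)),
      if_pos (by omega : 1 ≤ i), if_neg (by omega : ¬ (i ≤ -1)), if_neg (by omega : ¬ i = 0),
      if_pos (by omega : 0 ≤ i + 1), if_neg (by omega : ¬ (i + 1 < 0))]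
    ring
end

section
/- Let A be a commutative ring and δ, ε : A → A two derivations, extended coefficientwise to pseudo-difference operators over A. Let k, l ≥ 1 and let L⁺, L⁻ be pseudo-difference operators with coefficients of Λ^i vanishing for i > 1 (for L⁺) and for i < −1 (for L⁻), satisfying the large BKP constraint (L⁺)*∘(Λ−Λ⁻¹) = (Λ−Λ⁻¹)∘L⁻. For m ∈ {k, l} define B_m := ((L⁺)ᵐ)_{≥1} − ((L⁻)ᵐ)_{≤−1} − ( ((L⁺)ᵐ)_{≥1} − ((L⁻)ᵐ)_{≤−1} )|_{Λ=1}. Assume the Lax equations δL⁺ = [B_k, L⁺], δL⁻ = [B_k, L⁻], εL⁺ = [B_l, L⁺], εL⁻ = [B_l, L⁻]. Then the zero-curvature equation holds: δB_l − εB_k + [B_l, B_k] = 0. -/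
namespace BKPAux
open BKP

variable {A : Type*} [CommRing A]

/-- supported in degrees `≤ N` -/
def UB (N : ℤ) (C : ℤ → ℤ → A) : Prop := ∀ i : ℤ, N < i → ∀ n, C i n = 0

theorem comp_eq_sum {C D : ℤ → ℤ → A} {N M : ℤ} (hC : UB N C) (hD : UB M D) (p n a b : ℤ)
    (ha : a ≤ p - M) (hb : N ≤ b) :
    comp C D p n = ∑ i ∈ Finset.Icc a b, C i n * D (p - i) (n + i) := by
  unfold comp
  apply finsum_eq_sum_of_support_subset
  intro i hi
  simp only [Function.mem_support] at hi
  simp only [Finset.coe_Icc, Set.mem_Icc]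
  by_contra hcon
  apply hi
  by_cases h1 : N < i
  · rw [hC i h1, zero_mul]
  · rw [hD (p - i) (by omega), mul_zero]

theorem UB.comp {C D : ℤ → ℤ → A} {N M : ℤ} (hC : UB N C) (hD : UB M D) :
    UB (N + M) (comp C D) := by
  intro p hp n
  rw [comp_eq_sum hC hD p n (p - M) N le_rfl le_rfl]
  rw [Finset.Icc_eq_empty (by omega), Finset.sum_empty]

theorem UB.mono {C : ℤ → ℤ → A} {N M : ℤ} (hC : UB N C) (h : N ≤ M) : UB M C :=
  fun i hi n => hC i (by omega) n

theorem UB.add {C D : ℤ → ℤ → A} {N : ℤ} (hC : UB N C) (hD : UB N D) : UB N (C + D) := by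
  intro i hi n
  simp [hC i hi n, hD i hi n]

theorem UB.neg {C : ℤ → ℤ → A} {N : ℤ} (hC : UB N C) : UB N (-C) := by
  intro i hi n
  simp [hC i hi n]

theorem UB.sub {C D : ℤ → ℤ → A} {N : ℤ} (hC : UB N C) (hD : UB N D) : UB N (C - D) := by
  intro i hi n
  simp [hC i hi n, hD i hi n]

theorem UB.one : UB 0 (shift 0 : ℤ → ℤ → A) := by
  intro i hi n
  simp [shift, hi.ne']

theorem comp_assoc' {C D E : ℤ → ℤ → A} {N M K : ℤ} (hC : UB N C) (hD : UB M D) (hE : UB K E) :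
    comp (comp C D) E = comp C (comp D E) := by
  funext p n
  rw [comp_eq_sum (hC.comp hD) hE p n (p - K) (N + M) le_rfl le_rfl,
    comp_eq_sum hC (hD.comp hE) p n (p - K - M) N (by omega) le_rfl]
  have h1 : ∀ i ∈ Finset.Icc (p - K) (N + M), comp C D i n * E (p - i) (n + i) =
      ∑ j ∈ Finset.Icc (p - K - M) N, C j n * D (i - j) (n + j) * E (p - i) (n + i) := by
    intro i hi
    rw [Finset.mem_Icc] at hi
    rw [comp_eq_sum hC hD i n (p - K - M) N (by omega) le_rfl, Finset.sum_mul]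
  have h2 : ∀ j ∈ Finset.Icc (p - K - M) N, C j n * comp D E (p - j) (n + j) =
      ∑ i ∈ Finset.Icc (p - K) (N + M), C j n * D (i - j) (n + j) * E (p - i) (n + i) := by
    intro j hj
    rw [Finset.mem_Icc] at hj
    rw [comp_eq_sum hD hE (p - j) (n + j) (p - K - j) (N + M - j) (by omega) (by omega),
      Finset.mul_sum]
    refine Finset.sum_nbij' (fun i => i + j) (fun i => i - j) ?_ ?_ ?_ ?_ ?_
    · intro i hi; simp only [Finset.mem_Icc] at *; omega
    · intro i hi; simp only [Finset.mem_Icc] at *; omega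
    · intro i hi; simp
    · intro i hi; simp
    · intro i hi
      rw [mul_assoc, show i + j - j = i by ring, show p - j - i = p - (i + j) by ring,
        show n + j + i = n + (i + j) by ring]
  rw [Finset.sum_congr rfl h1, Finset.sum_congr rfl h2, Finset.sum_comm]

variable (A) in
/-- bounded above operators -/
def S : AddSubgroup (ℤ → ℤ → A) where
  carrier := {C | ∃ N, UB N C}
  add_mem' := by
    rintro C D ⟨N, hN⟩ ⟨M, hM⟩
    exact ⟨max N M, (hN.mono (le_max_left _ _)).add (hM.mono (le_max_right _ _))⟩
  zero_mem' := ⟨0, fun _ _ _ => rfl⟩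
  neg_mem' := by
    rintro C ⟨N, hN⟩
    exact ⟨N, hN.neg⟩

theorem comp_add' {C D E : ℤ → ℤ → A} (hC : C ∈ S A) (hD : D ∈ S A) (hE : E ∈ S A) :
    comp C (D + E) = comp C D + comp C E := by
  obtain ⟨N, hC⟩ := hC
  obtain ⟨M, hD⟩ := hD
  obtain ⟨K, hE⟩ := hE
  have hD := hD.mono (le_max_left M K)
  have hE := hE.mono (le_max_right M K)
  funext p n
  simp only [Pi.add_apply]
  rw [comp_eq_sum hC hD p n _ _ le_rfl le_rfl, comp_eq_sum hC hE p n _ _ le_rfl le_rfl,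
    comp_eq_sum hC (hD.add hE) p n _ _ le_rfl le_rfl, ← Finset.sum_add_distrib]
  simp [mul_add]

theorem add_comp' {C D E : ℤ → ℤ → A} (hC : C ∈ S A) (hD : D ∈ S A) (hE : E ∈ S A) :
    comp (D + E) C = comp D C + comp E C := by
  obtain ⟨N, hC⟩ := hC
  obtain ⟨M, hD⟩ := hD
  obtain ⟨K, hE⟩ := hE
  have hD := hD.mono (le_max_left M K)
  have hE := hE.mono (le_max_right M K)
  funext p n
  simp only [Pi.add_apply]
  rw [comp_eq_sum hD hC p n _ _ le_rfl le_rfl, comp_eq_sum hE hC p n _ _ le_rfl le_rfl,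
    comp_eq_sum (hD.add hE) hC p n _ _ le_rfl le_rfl, ← Finset.sum_add_distrib]
  simp [add_mul]

theorem one_comp' (C : ℤ → ℤ → A) : comp (shift 0) C = C := by
  funext p n
  unfold comp
  rw [finsum_eq_single _ (0 : ℤ)]
  · simp [shift]
  · intro i hi; simp [shift, hi]

theorem comp_one' (C : ℤ → ℤ → A) : comp C (shift 0) = C := by
  funext p n
  unfold comp
  rw [finsum_eq_single _ p]
  · simp [shift]
  · intro i hi
    have : p - i ≠ 0 := by omega
    simp [shift, this]

noncomputable instance : Mul (S A) :=
  ⟨fun C D => ⟨comp C.1 D.1, by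
    obtain ⟨N, hN⟩ := C.2
    obtain ⟨M, hM⟩ := D.2
    exact ⟨_, hN.comp hM⟩⟩⟩

noncomputable instance : One (S A) := ⟨⟨shift 0, 0, UB.one⟩⟩

theorem coe_mul' (C D : S A) : ((C * D : S A) : ℤ → ℤ → A) = comp C.1 D.1 := rfl

theorem coe_one' : ((1 : S A) : ℤ → ℤ → A) = shift 0 := rfl

noncomputable instance : Ring (S A) :=
  { (inferInstance : AddCommGroup (S A)), (inferInstance : Mul (S A)),
    (inferInstance : One (S A)) with
    left_distrib := fun a b c => Subtype.ext (comp_add' a.2 b.2 c.2)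
    right_distrib := fun a b c => Subtype.ext (add_comp' c.2 a.2 b.2)
    zero_mul := fun a => Subtype.ext (by
      rw [coe_mul']; funext p n; simp [comp])
    mul_zero := fun a => Subtype.ext (by
      rw [coe_mul']; funext p n; simp [comp])
    mul_assoc := fun a b c => Subtype.ext (by
      obtain ⟨N, hN⟩ := a.2
      obtain ⟨M, hM⟩ := b.2
      obtain ⟨K, hK⟩ := c.2
      exact comp_assoc' hN hM hK)
    one_mul := fun a => Subtype.ext (one_comp' a.1)
    mul_one := fun a => Subtype.ext (comp_one' a.1) }

theorem coe_pow' (C : S A) (m : ℕ) : ((C ^ m : S A) : ℤ → ℤ → A) = powOp C.1 m := by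
  induction m with
  | zero => rw [pow_zero]; rfl
  | succ m ih => rw [pow_succ', coe_mul', ih]; rfl

/-- coefficientwise derivation -/
def ap (δ : Derivation ℤ A A) (C : ℤ → ℤ → A) : ℤ → ℤ → A := fun i n => δ (C i n)

theorem UB.ap {C : ℤ → ℤ → A} {N : ℤ} (δ : Derivation ℤ A A) (hC : UB N C) : UB N (ap δ C) := by
  intro i hi n
  simp [BKPAux.ap, hC i hi n]

/-- coefficientwise derivation on `S` -/
def dS (δ : Derivation ℤ A A) : S A →+ S A where
  toFun C := ⟨ap δ C.1, by obtain ⟨N, hN⟩ := C.2; exact ⟨N, hN.ap δ⟩⟩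
  map_zero' := Subtype.ext (by funext i n; simp [ap])
  map_add' C D := Subtype.ext (by funext i n; simp [ap])

theorem dS_mul (δ : Derivation ℤ A A) (C D : S A) :
    dS δ (C * D) = dS δ C * D + C * dS δ D := by
  apply Subtype.ext
  obtain ⟨N, hN⟩ := C.2
  obtain ⟨M, hM⟩ := D.2
  change ap δ (comp C.1 D.1) = comp (ap δ C.1) D.1 + comp C.1 (ap δ D.1)
  funext p n
  simp only [Pi.add_apply]
  rw [comp_eq_sum (hN.ap δ) hM p n _ _ le_rfl le_rfl, comp_eq_sum hN (hM.ap δ) p n _ _ le_rfl le_rfl,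
    ap, comp_eq_sum hN hM p n _ _ le_rfl le_rfl, map_sum, ← Finset.sum_add_distrib]
  refine Finset.sum_congr rfl fun i _ => ?_
  simp only [Derivation.leibniz, ap, smul_eq_mul]
  ring

theorem dS_pow (δ : Derivation ℤ A A) (L B : S A) (h : dS δ L = B * L - L * B) (m : ℕ) :
    dS δ (L ^ m) = B * L ^ m - L ^ m * B := by
  induction m with
  | zero =>
    have := dS_mul δ (1 : S A) 1
    simp only [mul_one, one_mul] at this
    simp only [pow_zero, mul_one, one_mul, sub_self]
    simpa using this
  | succ m ih =>
    rw [pow_succ', dS_mul, ih, h]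
    noncomm_ring

theorem zc_ring (δ ε : Derivation ℤ A A) (Bk Bl P Q : S A) (hPQ : P * Q = Q * P)
    (hQ : dS δ Q = Bk * Q - Q * Bk) (hP : dS ε P = Bl * P - P * Bl) :
    dS δ Bl - dS ε Bk + (Bl * Bk - Bk * Bl) =
      dS δ (Bl - Q) - dS ε (Bk - P) + ((Bl - Q) * (Bk - P) - (Bk - P) * (Bl - Q)) := by
  rw [map_sub, map_sub, hQ, hP]
  have : Q * P = P * Q := hPQ.symm
  simp only [mul_sub, sub_mul, this]
  abel

theorem core (δ ε : Derivation ℤ A A) (Bk Bl L : ℤ → ℤ → A) (hBk : Bk ∈ S A) (hBl : Bl ∈ S A)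
    (hL : L ∈ S A) (k l : ℕ) (s : ℤ)
    (hδ : ap δ L = comp Bk L - comp L Bk) (hε : ap ε L = comp Bl L - comp L Bl)
    (hk : UB 0 (Bk - s • powOp L k)) (hl : UB 0 (Bl - s • powOp L l)) :
    UB 0 (ap δ Bl - ap ε Bk + (comp Bl Bk - comp Bk Bl)) := by
  let L' : S A := ⟨L, hL⟩
  let K' : S A := ⟨Bk, hBk⟩
  let B' : S A := ⟨Bl, hBl⟩
  have h1 : dS δ L' = K' * L' - L' * K' := Subtype.ext hδ
  have h2 : dS ε L' = B' * L' - L' * B' := Subtype.ext hε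
  have hz : ∀ (x : S A), ((s • x : S A) : ℤ → ℤ → A) = s • (x : ℤ → ℤ → A) :=
    fun x => map_zsmul (S A).subtype s x
  have hc : (L' ^ k) * (L' ^ l) = L' ^ l * L' ^ k := by rw [← pow_add, ← pow_add, add_comm]
  have key := zc_ring δ ε K' B' (s • L' ^ k) (s • L' ^ l)
    (by simp only [smul_mul_assoc, mul_smul_comm, hc])
    (by rw [map_zsmul, dS_pow δ L' K' h1]; simp only [smul_mul_assoc, mul_smul_comm, smul_sub])
    (by rw [map_zsmul, dS_pow ε L' B' h2]; simp only [smul_mul_assoc, mul_smul_comm, smul_sub])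
  have hk' : UB 0 (K' - s • L' ^ k : S A).1 := by
    rw [AddSubgroup.coe_sub, hz, coe_pow']; exact hk
  have hl' : UB 0 (B' - s • L' ^ l : S A).1 := by
    rw [AddSubgroup.coe_sub, hz, coe_pow']; exact hl
  have key2 := congrArg Subtype.val key
  change ap δ Bl - ap ε Bk + (comp Bl Bk - comp Bk Bl) = _ at key2
  rw [key2]
  exact ((hl'.ap δ).sub (hk'.ap ε)).add ((hl'.comp hk').sub (hk'.comp hl'))

/-- reflection -/
def rf (C : ℤ → ℤ → A) : ℤ → ℤ → A := fun i n => C (-i) (-n)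

theorem rf_comp (C D : ℤ → ℤ → A) : rf (comp C D) = comp (rf C) (rf D) := by
  funext p n
  simp only [rf, comp]
  rw [← finsum_comp_equiv (Equiv.neg ℤ)]
  refine finsum_congr fun i => ?_
  simp only [Equiv.neg_apply]
  rw [show -p - -i = -(p - i) by ring, show -n + -i = -(n + i) by ring]

theorem rf_pow (C : ℤ → ℤ → A) (m : ℕ) : rf (powOp C m) = powOp (rf C) m := by
  induction m with
  | zero => funext i n; simp [rf, powOp, shift]
  | succ m ih => simp only [powOp]; rw [rf_comp, ih]

theorem UB.pow {C : ℤ → ℤ → A} {N : ℤ} (hC : UB N C) (m : ℕ) : UB (m * N) (powOp C m) := by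
  induction m with
  | zero => simpa [powOp] using (UB.one : UB 0 (shift 0 : ℤ → ℤ → A))
  | succ m ih => exact (hC.comp ih).mono (by push_cast; linarith)

/-- sum of coefficients vanishes for compositions when it does for the right factor -/
theorem finsum_comp {C D : ℤ → ℤ → A} {N M K : ℤ} (hC : UB N C) (hC' : UB K (rf C))
    (hD : UB M D) (hD' : UB M (rf D)) (hs : ∀ n, ∑ᶠ i, D i n = 0) (n : ℤ) :
    ∑ᶠ i, comp C D i n = 0 := by
  have hDz : ∀ i, i < -M → ∀ n, D i n = 0 := fun i hi n => by
    have := hD' (-i) (by omega) (-n); simpa [rf] using this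
  have hCz : ∀ i, i < -K → ∀ n, C i n = 0 := fun i hi n => by
    have := hC' (-i) (by omega) (-n); simpa [rf] using this
  have h1 : ∀ p, comp C D p n = ∑ i ∈ Finset.Icc (-K) N, C i n * D (p - i) (n + i) := by
    intro p
    unfold comp
    apply finsum_eq_sum_of_support_subset
    intro i hi
    simp only [Function.mem_support] at hi
    simp only [Finset.coe_Icc, Set.mem_Icc]
    by_contra hcon
    apply hi
    by_cases h1 : N < i
    · rw [hC i h1, zero_mul]
    · rw [hCz i (by omega), zero_mul]
  simp only [h1]
  have hfin : ∀ i : ℤ, (Function.support fun p => D (p - i) (n + i)).Finite := by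
    intro i
    refine (Set.finite_Icc (-M + i) (M + i)).subset ?_
    intro p hp
    simp only [Function.mem_support] at hp
    simp only [Set.mem_Icc]
    by_contra hcon
    apply hp
    by_cases h1 : M < p - i
    · exact hD _ h1 _
    · exact hDz _ (by omega) _
  rw [finsum_sum_comm]
  · refine Finset.sum_eq_zero fun i _ => ?_
    rw [← mul_finsum' _ _ (hfin i)]
    have := finsum_comp_equiv (Equiv.subRight i) (f := fun q => D q (n + i))
    simp only [Equiv.subRight_apply] at this
    rw [this, hs, mul_zero]
  · intro i _
    refine (hfin i).subset ?_
    intro p hp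
    simp only [Function.mem_support] at hp ⊢
    exact right_ne_zero_of_mul hp

theorem fin_supp {C : ℤ → ℤ → A} {N M : ℤ} (hC : UB N C) (hC' : UB M (rf C)) (n : ℤ) :
    (Function.support fun i => C i n).Finite := by
  refine (Set.finite_Icc (-M) N).subset ?_
  intro i hp
  simp only [Function.mem_support] at hp
  simp only [Set.mem_Icc]
  by_contra hcon
  apply hp
  by_cases h1 : N < i
  · exact hC _ h1 _
  · have := hC' (-i) (by omega) (-n); simpa [rf] using this

theorem finsum_ap (δ : Derivation ℤ A A) {C : ℤ → ℤ → A} {N M : ℤ} (hC : UB N C)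
    (hC' : UB M (rf C)) (hs : ∀ n, ∑ᶠ i, C i n = 0) (n : ℤ) : ∑ᶠ i, ap δ C i n = 0 := by
  have := AddMonoidHom.map_finsum (δ : A →+ A) (fin_supp hC hC' n)
  rw [hs n] at this
  simpa [ap] using this.symm

/-- the generator -/
noncomputable def gen (Lp Lm : ℤ → ℤ → A) (k : ℕ) : ℤ → ℤ → A := fun i n =>
  truncGe 1 (powOp Lp k) i n - truncLe (-1) (powOp Lm k) i n -
    (if i = 0 then
      (∑ᶠ i' : ℤ, truncGe 1 (powOp Lp k) i' n) - ∑ᶠ i' : ℤ, truncLe (-1) (powOp Lm k) i' n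
    else 0)

section gen
variable {Lp Lm : ℤ → ℤ → A} (hp : UB 1 Lp) (hm : UB 1 (rf Lm)) (k : ℕ)

theorem low (hm : UB 1 (rf Lm)) (i : ℤ) (hi : i < -k) (n : ℤ) : powOp Lm k i n = 0 := by
  have := hm.pow k (-i) (by omega) (-n)
  rw [← rf_pow] at this
  simpa [rf] using this

include hp in
theorem gen_UB : UB k (gen Lp Lm k) := by
  intro i hi n
  have h := hp.pow k i (by omega) n
  have h0 : i ≠ 0 := by omega
  have h1 : ¬ i ≤ -1 := by omega
  simp [gen, truncGe, truncLe, h, h0, h1]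

include hm in
theorem gen_LB : UB k (rf (gen Lp Lm k)) := by
  intro i hi n
  have h := low k hm (-i) (by omega) (-n)
  have h0 : i ≠ 0 := by omega
  have h1 : ¬ 1 ≤ -i := by omega
  simp [rf, gen, truncGe, truncLe, h, h0, h1]

theorem gen_p : UB 0 (gen Lp Lm k - (1 : ℤ) • powOp Lp k) := by
  intro i hi n
  have h0 : i ≠ 0 := by omega
  have h1 : ¬ i ≤ -1 := by omega
  have h2 : 1 ≤ i := by omega
  simp [gen, truncGe, truncLe, h0, h1, h2]

theorem gen_m : UB 0 (rf (gen Lp Lm k) - (-1 : ℤ) • powOp (rf Lm) k) := by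
  intro i hi n
  have h0 : i ≠ 0 := by omega
  have h1 : ¬ 1 ≤ -i := by omega
  have h2 : 1 ≤ i := by omega
  rw [← rf_pow]
  simp [gen, rf, truncGe, truncLe, h0, h1, h2]

include hp hm in
theorem gen_sum (n : ℤ) : ∑ᶠ i, gen Lp Lm k i n = 0 := by
  have f1 : (Function.support fun i => truncGe 1 (powOp Lp k) i n).Finite := by
    refine (Set.finite_Icc 1 (k : ℤ)).subset ?_
    intro i hi
    simp only [Function.mem_support] at hi
    simp only [Set.mem_Icc]
    by_contra hcon
    apply hi
    unfold truncGe
    split_ifs with h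
    · exact hp.pow k i (by omega) n
    · rfl
  have f2 : (Function.support fun i => truncLe (-1) (powOp Lm k) i n).Finite := by
    refine (Set.finite_Icc (-k : ℤ) (-1)).subset ?_
    intro i hi
    simp only [Function.mem_support] at hi
    simp only [Set.mem_Icc]
    by_contra hcon
    apply hi
    unfold truncLe
    split_ifs with h
    · exact low k hm i (by omega) n
    · rfl
  unfold gen
  have hd : ∀ a : A, ∑ᶠ i : ℤ, (if i = 0 then a else 0) = a := by
    intro a
    rw [finsum_eq_single _ (0 : ℤ) (fun i hi => if_neg hi), if_pos rfl]
  rw [finsum_sub_distrib, finsum_sub_distrib f1 f2, hd, sub_self]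
  · refine (f1.union f2).subset ?_
    intro i hi
    simp only [Function.mem_support, Set.mem_union] at hi ⊢
    by_contra hcon
    push Not at hcon
    exact hi (by rw [hcon.1, hcon.2, sub_zero])
  · refine (Set.finite_singleton (0 : ℤ)).subset ?_
    intro i hi
    simp only [Function.mem_support] at hi
    by_contra hcon
    exact hi (if_neg hcon)
end gen

end BKPAux

open BKPAux

/-- Zero-curvature equation for the large BKP flow generators: if `δ, ε` are
derivations, `L⁺` (supported in powers `≤ 1`) and `L⁻` (supported in powers `≥ −1`)
satisfy the constraint `(L⁺)*∘(Λ−Λ⁻¹) = (Λ−Λ⁻¹)∘L⁻`, the flow generators are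
`B_m = ((L⁺)ᵐ)_{≥1} − ((L⁻)ᵐ)_{≤−1} − (((L⁺)ᵐ)_{≥1} − ((L⁻)ᵐ)_{≤−1})|_{Λ=1}` for
`m ∈ {k, l}`, and the Lax equations `δL^± = [B_k, L^±]`, `εL^± = [B_l, L^±]` hold,
then `δB_l − εB_k + [B_l, B_k] = 0`. -/
theorem stmt12 {A : Type*} [CommRing A] (δ ε : Derivation ℤ A A)
    (k l : ℕ) (hk : 1 ≤ k) (hl : 1 ≤ l)
    (Lp Lm : ℤ → ℤ → A)
    (hLp : ∀ i : ℤ, 1 < i → ∀ n : ℤ, Lp i n = 0)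
    (hLm : ∀ i : ℤ, i < -1 → ∀ n : ℤ, Lm i n = 0)
    (hcon : BKP.comp (BKP.adj Lp) BKP.lam = BKP.comp BKP.lam Lm)
    (Bk Bl : ℤ → ℤ → A)
    (hBk : Bk = fun i n =>
      BKP.truncGe 1 (BKP.powOp Lp k) i n - BKP.truncLe (-1) (BKP.powOp Lm k) i n -
        (if i = 0 then
          (∑ᶠ i' : ℤ, BKP.truncGe 1 (BKP.powOp Lp k) i' n) -
            ∑ᶠ i' : ℤ, BKP.truncLe (-1) (BKP.powOp Lm k) i' n
        else 0))
    (hBl : Bl = fun i n =>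
      BKP.truncGe 1 (BKP.powOp Lp l) i n - BKP.truncLe (-1) (BKP.powOp Lm l) i n -
        (if i = 0 then
          (∑ᶠ i' : ℤ, BKP.truncGe 1 (BKP.powOp Lp l) i' n) -
            ∑ᶠ i' : ℤ, BKP.truncLe (-1) (BKP.powOp Lm l) i' n
        else 0))
    (hLaxPk : (fun i n => δ (Lp i n)) = BKP.comp Bk Lp - BKP.comp Lp Bk)
    (hLaxMk : (fun i n => δ (Lm i n)) = BKP.comp Bk Lm - BKP.comp Lm Bk)
    (hLaxPl : (fun i n => ε (Lp i n)) = BKP.comp Bl Lp - BKP.comp Lp Bl)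
    (hLaxMl : (fun i n => ε (Lm i n)) = BKP.comp Bl Lm - BKP.comp Lm Bl) :
    (fun i n => δ (Bl i n)) - (fun i n => ε (Bk i n)) +
      (BKP.comp Bl Bk - BKP.comp Bk Bl) = 0 := by
  have hp : UB 1 Lp := hLp
  have hm : UB 1 (rf Lm) := fun i hi n => hLm (-i) (by omega) (-n)
  have eBk : Bk = gen Lp Lm k := hBk
  have eBl : Bl = gen Lp Lm l := hBl
  have uk : UB k Bk := eBk ▸ gen_UB hp k
  have ul : UB l Bl := eBl ▸ gen_UB hp l
  have dk : UB k (rf Bk) := eBk ▸ gen_LB hm k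
  have dl : UB l (rf Bl) := eBl ▸ gen_LB hm l
  have sk : ∀ n, ∑ᶠ i, Bk i n = 0 := eBk ▸ gen_sum hp hm k
  have sl : ∀ n, ∑ᶠ i, Bl i n = 0 := eBl ▸ gen_sum hp hm l
  have up := core δ ε Bk Bl Lp ⟨_, uk⟩ ⟨_, ul⟩ ⟨_, hp⟩ k l 1 hLaxPk hLaxPl
    (eBk ▸ gen_p k) (eBl ▸ gen_p l)
  have rsub : ∀ C D : ℤ → ℤ → A, rf (C - D) = rf C - rf D := fun _ _ => rfl
  have dn := core δ ε (rf Bk) (rf Bl) (rf Lm) ⟨_, dk⟩ ⟨_, dl⟩ ⟨_, hm⟩ k l (-1)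
    (by rw [← rf_comp, ← rf_comp, ← rsub, ← hLaxMk]; rfl)
    (by rw [← rf_comp, ← rf_comp, ← rsub, ← hLaxMl]; rfl)
    (eBk ▸ gen_m k) (eBl ▸ gen_m l)
  rw [← rf_comp, ← rf_comp] at dn
  change ap δ Bl - ap ε Bk + (BKP.comp Bl Bk - BKP.comp Bk Bl) = 0
  have dn' : UB 0 (rf (ap δ Bl - ap ε Bk + (BKP.comp Bl Bk - BKP.comp Bk Bl))) := dn
  have c1 := finsum_comp ul dl uk dk sk
  have c2 := finsum_comp uk dk ul dl sl
  have a1 := finsum_ap δ ul dl sl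
  have a2 := finsum_ap ε uk dk sk
  have g1 := fin_supp (ul.ap δ) (show UB l (rf (ap δ Bl)) from dl.ap δ)
  have g2 := fin_supp (uk.ap ε) (show UB k (rf (ap ε Bk)) from dk.ap ε)
  have g3 := fin_supp (ul.comp uk) (show UB (l + k) (rf (BKP.comp Bl Bk)) by
    rw [rf_comp]; exact dl.comp dk)
  have g4 := fin_supp (uk.comp ul) (show UB (k + l) (rf (BKP.comp Bk Bl)) by
    rw [rf_comp]; exact dk.comp dl)
  have off : ∀ i n, i ≠ 0 →
      (ap δ Bl - ap ε Bk + (BKP.comp Bl Bk - BKP.comp Bk Bl)) i n = 0 := by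
    intro i n hi
    rcases lt_or_gt_of_ne hi with h | h
    · have := dn' (-i) (by omega) (-n)
      simpa only [rf, neg_neg] using this
    · exact up i h n
  funext i n
  by_cases hi : i = 0
  · subst hi
    rw [← finsum_eq_single (fun i => (ap δ Bl - ap ε Bk +
      (BKP.comp Bl Bk - BKP.comp Bk Bl)) i n) 0 (fun i hi => off i n hi)]
    simp only [Pi.add_apply, Pi.sub_apply]
    have fs : ∀ {f g : ℤ → A}, f.support.Finite → g.support.Finite →
        (Function.support fun i => f i - g i).Finite := fun {f g} hf hg =>
      (hf.union hg).subset (Function.support_sub f g)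
    rw [finsum_add_distrib (fs (g1 n) (g2 n)) (fs (g3 n) (g4 n)),
      finsum_sub_distrib (g1 n) (g2 n), finsum_sub_distrib (g3 n) (g4 n), a1, a2, c1, c2]
    simp
  · exact off i n hi
end

section
/- Let R be a commutative ring and let L⁺ = ∑_{j=−1}^{∞} u⁺_j(n)Λ^{−j} and L⁻ = ∑_{j=−1}^{∞} u⁻_j(n)Λ^{j} be pseudo-difference operators satisfying the large BKP constraint (L⁺)*∘(Λ−Λ⁻¹) = (Λ−Λ⁻¹)∘L⁻, and write u(n) := u⁺_{−1}(n). For m ≥ 1 define B_m := ((L⁺)ᵐ)_{≥1} − ((L⁻)ᵐ)_{≤−1} − ( ((L⁺)ᵐ)_{≥1} − ((L⁻)ᵐ)_{≤−1} )|_{Λ=1}. Then: (1) B₁ = u(n)·(Λ−Λ⁻¹), i.e. B₁ = D¹∘(Λ−Λ⁻¹) where D¹ is the multiplication operator by u; and (2) B₂ = D²∘(Λ−Λ⁻¹), where D² is the operator with Λ⁰-coefficient u(n)(u⁺₀(n+1)+u⁺₀(n)), Λ¹-coefficient u(n)u(n+1), Λ⁻¹-coefficient u(n−1)u(n), and all other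 coefficients zero (i.e. B₂ = ( u(n)(u⁺₀(n+1)+u⁺₀(n)) + u(n)u(n+1)Λ + Λ⁻¹u(n)u(n+1) )(Λ−Λ⁻¹)). -/
namespace BKP

theorem fsum_aux {R : Type*} [CommRing R] (f : ℤ → R) (s : Finset ℤ)
    (h : ∀ i, i ∉ s → f i = 0) : ∑ᶠ i, f i = ∑ i ∈ s, f i := by
  apply finsum_eq_sum_of_support_subset
  intro i hi
  by_contra hc
  exact hi (h i (by simpa using hc))

theorem comp_lam {R : Type*} [CommRing R] (C : ℤ → ℤ → R) (p n : ℤ) :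
    comp C lam p n = C (p - 1) n - C (p + 1) n := by
  unfold comp lam
  rw [fsum_aux _ {p - 1, p + 1}, Finset.sum_pair (by omega)]
  · rw [if_pos (by omega), if_neg (by omega), if_pos (by omega)]
    ring
  · intro i hi
    simp only [Finset.mem_insert, Finset.mem_singleton, not_or] at hi
    rw [if_neg (by omega), if_neg (by omega), mul_zero]

theorem lam_comp {R : Type*} [CommRing R] (C : ℤ → ℤ → R) (p n : ℤ) :
    comp lam C p n = C (p - 1) (n + 1) - C (p + 1) (n - 1) := by
  unfold comp lam
  rw [fsum_aux _ {1, -1}, Finset.sum_pair (by omega)]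
  · rw [if_pos rfl, if_neg (by omega), if_pos rfl, sub_neg_eq_add, ← sub_eq_add_neg]
    ring
  · intro i hi
    simp only [Finset.mem_insert, Finset.mem_singleton, not_or] at hi
    rw [if_neg (by omega), if_neg (by omega), zero_mul]

theorem powOp_one {R : Type*} [CommRing R] (C : ℤ → ℤ → R) : powOp C 1 = C := by
  funext p n
  change comp C (shift 0) p n = C p n
  unfold comp shift
  rw [fsum_aux _ {p}, Finset.sum_singleton, if_pos (by omega), mul_one]
  intro i hi
  simp only [Finset.mem_singleton] at hi
  rw [if_neg (by omega), mul_zero]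

theorem powOp_two {R : Type*} [CommRing R] (C : ℤ → ℤ → R) : powOp C 2 = comp C C := by
  change comp C (powOp C 1) = _
  rw [powOp_one]

end BKP

/-- Explicit examples of the large BKP flow generators: with
`L⁺ = ∑_{j=−1}^{∞} u⁺_j(n)Λ^{−j}`, `L⁻ = ∑_{j=−1}^{∞} u⁻_j(n)Λ^{j}` satisfying the
constraint `(L⁺)*∘(Λ−Λ⁻¹) = (Λ−Λ⁻¹)∘L⁻`, `u := u⁺_{−1}`, and
`B_m = ((L⁺)ᵐ)_{≥1} − ((L⁻)ᵐ)_{≤−1} − (((L⁺)ᵐ)_{≥1} − ((L⁻)ᵐ)_{≤−1})|_{Λ=1}` for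
`m ≥ 1`, one has `B₁ = u(n)(Λ−Λ⁻¹)` and
`B₂ = (u(n)(u⁺₀(n+1)+u⁺₀(n)) + u(n)u(n+1)Λ + Λ⁻¹u(n)u(n+1))(Λ−Λ⁻¹)`. -/
theorem stmt13 {R : Type*} [CommRing R] (up um : ℤ → ℤ → R) (Lp Lm : ℤ → ℤ → R)
    (hLp : ∀ i n : ℤ, Lp i n = if i ≤ 1 then up (-i) n else 0)
    (hLm : ∀ i n : ℤ, Lm i n = if -1 ≤ i then um i n else 0)
    (hcon : BKP.comp (BKP.adj Lp) BKP.lam = BKP.comp BKP.lam Lm)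
    (u : ℤ → R) (hu : ∀ n : ℤ, u n = up (-1) n)
    (B : ℕ → ℤ → ℤ → R)
    (hB : ∀ m : ℕ, 1 ≤ m → B m = fun i n =>
      BKP.truncGe 1 (BKP.powOp Lp m) i n - BKP.truncLe (-1) (BKP.powOp Lm m) i n -
        (if i = 0 then
          (∑ᶠ i' : ℤ, BKP.truncGe 1 (BKP.powOp Lp m) i' n) -
            ∑ᶠ i' : ℤ, BKP.truncLe (-1) (BKP.powOp Lm m) i' n
        else 0)) :
    B 1 = BKP.comp (fun i n => if i = 0 then u n else 0) BKP.lam ∧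
    B 2 = BKP.comp
      (fun i n =>
        if i = 0 then u n * (up 0 (n + 1) + up 0 n)
        else if i = 1 then u n * u (n + 1)
        else if i = -1 then u (n - 1) * u n
        else 0) BKP.lam := by
  have hp0 : ∀ i n : ℤ, 1 < i → Lp i n = 0 := fun i n h => by rw [hLp, if_neg (by omega)]
  have hm0 : ∀ i n : ℤ, i < -1 → Lm i n = 0 := fun i n h => by rw [hLm, if_neg (by omega)]
  have hp1 : ∀ n, Lp 1 n = u n := fun n => by rw [hLp, if_pos (by omega), hu]
  have hpz : ∀ n, Lp 0 n = up 0 n := fun n => by rw [hLp, if_pos (by omega), neg_zero]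
  have hc : ∀ p n : ℤ, Lp (-(p - 1)) (n + (p - 1)) - Lp (-(p + 1)) (n + (p + 1))
      = Lm (p - 1) (n + 1) - Lm (p + 1) (n - 1) := fun p n => by
    have := congrFun (congrFun hcon p) n
    rw [BKP.comp_lam, BKP.lam_comp] at this
    exact this
  have hm1 : ∀ n, Lm (-1) n = u n := fun n => by
    have := hc (-2) (n + 1)
    norm_num at this
    rw [hp0 3 _ (by omega), hm0 (-3) _ (by omega), hp1] at this
    simpa using this.symm
  have hmz : ∀ n, Lm 0 n = up 0 (n + 1) := fun n => by
    have := hc (-1) (n + 1)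
    norm_num at this
    rw [hp0 2 _ (by omega), hm0 (-2) _ (by omega), hpz] at this
    simpa using this.symm
  have hP0 : ∀ i n : ℤ, 2 < i → BKP.comp Lp Lp i n = 0 := fun i n h => by
    unfold BKP.comp
    rw [BKP.fsum_aux _ ∅, Finset.sum_empty]
    intro j _
    by_cases hj : 1 < j
    · rw [hp0 j _ hj, zero_mul]
    · rw [hp0 (i - j) _ (by omega), mul_zero]
  have hP2 : ∀ n : ℤ, BKP.comp Lp Lp 2 n = u n * u (n + 1) := fun n => by
    unfold BKP.comp
    rw [BKP.fsum_aux _ {1}, Finset.sum_singleton]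
    · norm_num [hp1]
    intro j hj
    simp only [Finset.mem_singleton] at hj
    by_cases hj : 1 < j
    · rw [hp0 j _ hj, zero_mul]
    · rw [hp0 (2 - j) _ (by omega), mul_zero]
  have hP1 : ∀ n : ℤ, BKP.comp Lp Lp 1 n = u n * (up 0 (n + 1) + up 0 n) := fun n => by
    unfold BKP.comp
    rw [BKP.fsum_aux _ {0, 1}, Finset.sum_pair (by omega)]
    · norm_num [hp1, hpz]
      ring
    intro j hj
    simp only [Finset.mem_insert, Finset.mem_singleton, not_or] at hj
    by_cases hj : 1 < j
    · rw [hp0 j _ hj, zero_mul]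
    · rw [hp0 (1 - j) _ (by omega), mul_zero]
  have hM0 : ∀ i n : ℤ, i < -2 → BKP.comp Lm Lm i n = 0 := fun i n h => by
    unfold BKP.comp
    rw [BKP.fsum_aux _ ∅, Finset.sum_empty]
    intro j _
    by_cases hj : j < -1
    · rw [hm0 j _ hj, zero_mul]
    · rw [hm0 (i - j) _ (by omega), mul_zero]
  have hM2 : ∀ n : ℤ, BKP.comp Lm Lm (-2) n = u (n - 1) * u n := fun n => by
    unfold BKP.comp
    rw [BKP.fsum_aux _ {-1}, Finset.sum_singleton]
    · norm_num [hm1, ← sub_eq_add_neg]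
      ring
    intro j hj
    simp only [Finset.mem_singleton] at hj
    by_cases hj : j < -1
    · rw [hm0 j _ hj, zero_mul]
    · rw [hm0 (-2 - j) _ (by omega), mul_zero]
  have hM1 : ∀ n : ℤ, BKP.comp Lm Lm (-1) n = u n * (up 0 (n + 1) + up 0 n) := fun n => by
    unfold BKP.comp
    rw [BKP.fsum_aux _ {0, -1}, Finset.sum_pair (by omega)]
    · norm_num [hm1, hmz]
      ring
    intro j hj
    simp only [Finset.mem_insert, Finset.mem_singleton, not_or] at hj
    by_cases hj : j < -1
    · rw [hm0 j _ hj, zero_mul]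
    · rw [hm0 (-1 - j) _ (by omega), mul_zero]
  constructor
  · rw [hB 1 le_rfl, BKP.powOp_one, BKP.powOp_one]
    funext i n
    rw [BKP.comp_lam, BKP.fsum_aux _ {1}, BKP.fsum_aux _ {-1}, Finset.sum_singleton,
      Finset.sum_singleton]
    · simp only [BKP.truncGe, BKP.truncLe]
      rcases (by omega : i < -1 ∨ i = -1 ∨ i = 0 ∨ i = 1 ∨ 1 < i) with h | h | h | h | h
      · rw [hm0 i n h]
        grind
      · subst h; norm_num [hm1]
      · subst h; norm_num [hm1, hp1]
      · subst h; norm_num [hp1]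
      · rw [hp0 i n h]
        grind
    · intro j hj
      simp only [Finset.mem_singleton] at hj
      unfold BKP.truncLe
      split_ifs
      · exact hm0 _ _ (by omega)
      · rfl
    · intro j hj
      simp only [Finset.mem_singleton] at hj
      unfold BKP.truncGe
      split_ifs
      · exact hp0 _ _ (by omega)
      · rfl
  · rw [hB 2 (by omega), BKP.powOp_two, BKP.powOp_two]
    funext i n
    rw [BKP.comp_lam, BKP.fsum_aux _ {1, 2}, BKP.fsum_aux _ {-1, -2},
      Finset.sum_pair (by omega), Finset.sum_pair (by omega)]
    · simp only [BKP.truncGe, BKP.truncLe]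
      rcases (by omega : i < -2 ∨ i = -2 ∨ i = -1 ∨ i = 0 ∨ i = 1 ∨ i = 2 ∨ 2 < i) with
        h | h | h | h | h | h | h
      · rw [hM0 i n h]
        grind
      · subst h; norm_num [hM2]
      · subst h; norm_num [hM1]
      · subst h
        norm_num [hM1, hM2, hP1, hP2]
      · subst h; norm_num [hP1]
      · subst h; norm_num [hP2]
      · rw [hP0 i n h]
        grind
    · intro j hj
      simp only [Finset.mem_insert, Finset.mem_singleton, not_or] at hj
      unfold BKP.truncLe
      split_ifs
      · exact hM0 _ _ (by omega)
      · rfl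
    · intro j hj
      simp only [Finset.mem_insert, Finset.mem_singleton, not_or] at hj
      unfold BKP.truncGe
      split_ifs
      · exact hP0 _ _ (by omega)
      · rfl
end

section
/- Let A be a commutative ring and δ₁, δ₂ : A → A two derivations. Let u, u₀, u₁ : ℤ → A with u(n) invertible for every n, and suppose the following three equations (the t₁- and t₂-flows of the large BKP hierarchy on the leading Lax coefficients) hold for all n ∈ ℤ: δ₁u(n) = u(n)(u₀(n+1) − u₀(n)); δ₁u₀(n) = u(n)(u₁(n+1) − u(n−1) + u(n+1)) − u₁(n)u(n−1); δ₂u(n) = u(n)u(n+1)(u₁(n+2) + u(n+2) − 2u(n)) + u(n)(u₀(n+1) + u₀(n))(u₀(n+1) − u₀(n)) + u(n)u(n−1)(u(n) − u₁(n)). Define f₀(n) := u(n)(u₀(n+1) + u₀(n)). Then for all n ∈ ℤ the integrable discretization of the Novikov–Veselov equation holds: (1) δ₁(u(n)u(n+1))·(u(n)u(n+1))⁻¹ = f₀(n+1)·u(n+1)⁻¹ − f₀(n)·u(n)⁻¹, and (2) δ₂u(n) − δ₁f₀(n) + 2·u(n)²·(u(n+1) − u(n−1)) = 0. -/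
/-- The integrable discretization of the Novikov–Veselov equation from the first two
large BKP flows: if `δ₁, δ₂` are derivations of a commutative ring `A`,
`u, u₀, u₁ : ℤ → A` with each `u(n)` a unit, and the `t₁`- and `t₂`-flow equations
`δ₁u(n) = u(n)(u₀(n+1) − u₀(n))`,
`δ₁u₀(n) = u(n)(u₁(n+1) − u(n−1) + u(n+1)) − u₁(n)u(n−1)`,
`δ₂u(n) = u(n)u(n+1)(u₁(n+2) + u(n+2) − 2u(n)) + u(n)(u₀(n+1)+u₀(n))(u₀(n+1)−u₀(n))
  + u(n)u(n−1)(u(n) − u₁(n))` hold, then with `f₀(n) := u(n)(u₀(n+1) + u₀(n))`: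
`δ₁(u(n)u(n+1))·(u(n)u(n+1))⁻¹ = f₀(n+1)/u(n+1) − f₀(n)/u(n)` and
`δ₂u(n) − δ₁f₀(n) + 2u(n)²(u(n+1) − u(n−1)) = 0`. -/
theorem stmt14 {A : Type*} [CommRing A] (δ₁ δ₂ : Derivation ℤ A A)
    (u u₀ u₁ : ℤ → A) (hu : ∀ n : ℤ, IsUnit (u n))
    (h1 : ∀ n : ℤ, δ₁ (u n) = u n * (u₀ (n + 1) - u₀ n))
    (h2 : ∀ n : ℤ, δ₁ (u₀ n)
      = u n * (u₁ (n + 1) - u (n - 1) + u (n + 1)) - u₁ n * u (n - 1))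
    (h3 : ∀ n : ℤ, δ₂ (u n)
      = u n * u (n + 1) * (u₁ (n + 2) + u (n + 2) - 2 * u n)
        + u n * (u₀ (n + 1) + u₀ n) * (u₀ (n + 1) - u₀ n)
        + u n * u (n - 1) * (u n - u₁ n))
    (f₀ : ℤ → A) (hf₀ : ∀ n : ℤ, f₀ n = u n * (u₀ (n + 1) + u₀ n)) :
    ∀ n : ℤ,
      δ₁ (u n * u (n + 1)) * Ring.inverse (u n * u (n + 1))
        = f₀ (n + 1) * Ring.inverse (u (n + 1)) - f₀ n * Ring.inverse (u n) ∧
      δ₂ (u n) - δ₁ (f₀ n) + 2 * (u n) ^ 2 * (u (n + 1) - u (n - 1)) = 0 := by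
  intro n
  have e1 : n + 1 + 1 = n + 2 := by ring
  have e2 : n + 1 - 1 = n := by ring
  constructor
  · have a := Ring.mul_inverse_cancel _ (hu n)
    have b := Ring.mul_inverse_cancel _ (hu (n + 1))
    have c := Ring.mul_inverse_cancel _ ((hu n).mul (hu (n + 1)))
    have hl : δ₁ (u n * u (n + 1)) = (u n * u (n + 1)) * (u₀ (n + 2) - u₀ n) := by
      rw [Derivation.leibniz, h1, h1, e1]
      simp only [smul_eq_mul]
      ring
    rw [hl, hf₀, hf₀, e1]
    linear_combination (u₀ (n + 2) - u₀ n) * c - (u₀ (n + 2) + u₀ (n + 1)) * b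
      + (u₀ (n + 1) + u₀ n) * a
  · rw [hf₀, Derivation.leibniz, map_add, h1, h2, h2, h3, e1, e2]
    simp only [smul_eq_mul]
    ring
end
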